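/- Let Q = (J,σ,ξ) be a Q-datum. Then the set of all reduced words of the longest element w₀ that are adapted to Q is nonempty and forms a single commutation equivalence class: any two Q-adapted reduced words are commutation equivalent, and any reduced word commutation equivalent to a Q-adapted one is Q-adapted. -/

import Mathlib

open scoped BigOperators Classical

namespace QDatumPaper

structure CartanADE (J : Type) [Fintype J] [DecidableEq J] where
  a : J → J → ℤ
  symm : ∀ ι j : J, a ι j = a j ι
  diag : ∀ ι : J, a ι ι = 2
  offDiag : ∀ ι j : J, ι ≠ j → a ι j = 0 ∨ a ι j = -1
  posDef : ∀ v : J → ℚ, v ≠ 0 → 0 < ∑ ι : J, ∑ j : J, v ι * (a ι j : ℚ) * v j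
  indec : ∀ s : Set J, s.Nonempty →
    (∀ ι ∈ s, ∀ j : J, a ι j = -1 → j ∈ s) → s = Set.univ

variable {J : Type} [Fintype J] [DecidableEq J]

/-- `j` lies in the `σ`-orbit of `ι`. -/
def SameOrbit (σ : Equiv.Perm J) (ι j : J) : Prop := ∃ k : ℕ, (σ ^ k) ι = j

/-- The size `𝗌_{\barι}` of the `σ`-orbit of `ι`. -/
noncomputable def orbitSize (σ : Equiv.Perm J) (ι : J) : ℕ :=
  ((Finset.range (orderOf σ)).image fun k => (σ ^ k) ι).card

/-- A diagram automorphism of the Cartan matrix `C`: no two distinct vertices in a common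
orbit are adjacent. -/
structure DiagAut (C : CartanADE J) where
  σ : Equiv.Perm J
  compat : ∀ ι j : J, C.a (σ ι) (σ j) = C.a ι j
  noAdj : ∀ (ι : J) (k : ℕ), (σ ^ k) ι ≠ ι → C.a ι ((σ ^ k) ι) ≠ -1

/-- Height function on `(J, σ)`. -/
def IsHeightFunction (C : CartanADE J) (D : DiagAut C) (ξ : J → ℤ) : Prop :=
  (∀ ι j : J, C.a ι j = -1 → orbitSize D.σ ι = orbitSize D.σ j →
      |ξ ι - ξ j| = (orbitSize D.σ ι : ℤ)) ∧
  (∀ ι j : J, C.a ι j = -1 → orbitSize D.σ ι < orbitSize D.σ j →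
      ∃! j0 : J, SameOrbit D.σ j j0 ∧ |ξ ι - ξ j0| = 1 ∧
        ∀ k : ℕ, k < orderOf D.σ → ξ ((D.σ ^ k) j0) = ξ j0 - 2 * (k : ℤ))

/-- Symmetric bilinear form on the root lattice `ℤ^J`. -/
def pairing (C : CartanADE J) (v w : J → ℤ) : ℤ := ∑ ι : J, ∑ j : J, v ι * C.a ι j * w j

/-- Positive roots. -/
def posRoots (C : CartanADE J) : Set (J → ℤ) :=
  {v | (∀ ι : J, 0 ≤ v ι) ∧ v ≠ 0 ∧ pairing C v v = 2}

def simpleRoot (ι : J) : J → ℤ := fun j => if j = ι then 1 else 0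

/-- Simple reflection `s_ι` on the root lattice. -/
def reflS (C : CartanADE J) (ι : J) (v : J → ℤ) : J → ℤ :=
  fun j => v j - (∑ κ : J, v κ * C.a κ ι) * simpleRoot ι j

/-- `applyRefls C [ι₁, …, ι_m] v = s_{ι₁}(s_{ι₂}(⋯ s_{ι_m}(v)⋯))`. -/
def applyRefls (C : CartanADE J) (w : List J) (v : J → ℤ) : J → ℤ :=
  w.foldr (reflS C) v

/-- `β_k = s_{ι₁} ⋯ s_{ι_{k-1}} (α_{ι_k})`. -/
def betaOf (C : CartanADE J) {L : ℕ} (ii : Fin L → J) (k : Fin L) : J → ℤ :=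
  applyRefls C ((List.ofFn ii).take k.1) (simpleRoot (ii k))

/-- `ii` is a reduced word of the longest element. -/
def IsReducedWord (C : CartanADE J) {L : ℕ} (ii : Fin L → J) : Prop :=
  L = (posRoots C).ncard ∧ Function.Injective (betaOf C ii) ∧
    ∀ k : Fin L, betaOf C ii k ∈ posRoots C

def pairingQ (C : CartanADE J) (v w : J → ℚ) : ℚ :=
  ∑ ι : J, ∑ j : J, v ι * (C.a ι j : ℚ) * w j

def reflQ (C : CartanADE J) (ι : J) (v : J → ℚ) : J → ℚ :=
  fun j => v j - (∑ κ : J, v κ * (C.a κ ι : ℚ)) * (if j = ι then 1 else 0)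

def applyReflsQ (C : CartanADE J) (w : List J) (v : J → ℚ) : J → ℚ :=
  w.foldr (reflQ C) v

/-- `Λ` is a system of fundamental weights: `(Λ_ι, α_j) = δ_{ιj}`. -/
def IsFundWeights (C : CartanADE J) (Λ : J → J → ℚ) : Prop :=
  ∀ ι j : J, pairingQ C (Λ ι) (fun κ => (simpleRoot j κ : ℚ)) = if ι = j then 1 else 0

/-- `ν_k = -(s_{ι₁} ⋯ s_{ι_k})(Λ_{ι_k})`. -/
def nuOf (C : CartanADE J) {L : ℕ} (ii : Fin L → J) (Λ : J → J → ℚ) (k : Fin L) : J → ℚ :=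
  - applyReflsQ C ((List.ofFn ii).take (k.1 + 1)) (Λ (ii k))

def betaQ (C : CartanADE J) {L : ℕ} (ii : Fin L → J) (k : Fin L) : J → ℚ :=
  fun j => (betaOf C ii k j : ℚ)

/-- The pairing `(ν_k, β_t)`. -/
def nuBetaPair (C : CartanADE J) {L : ℕ} (ii : Fin L → J) (Λ : J → J → ℚ) (k t : Fin L) : ℚ :=
  pairingQ C (nuOf C ii Λ k) (betaQ C ii t)

/-- `m` is a Kostant partition of `β`. -/
def IsKP (C : CartanADE J) (β : J → ℤ) (m : (J → ℤ) → ℤ) : Prop :=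
  (∀ v : J → ℤ, v ∉ posRoots C → m v = 0) ∧ (∀ v ∈ posRoots C, 0 ≤ m v) ∧
    ∑ᶠ v ∈ posRoots C, m v • v = β

/-- `ρ^ii(m)_r = Σ_{t ≤ r} m(β_t)(ν_r, β_t)`. -/
def rhoOf (C : CartanADE J) {L : ℕ} (ii : Fin L → J) (Λ : J → J → ℚ)
    (m : (J → ℤ) → ℤ) (r : Fin L) : ℚ :=
  ∑ t ∈ Finset.univ.filter (fun t : Fin L => t ≤ r),
    (m (betaOf C ii t) : ℚ) * nuBetaPair C ii Λ r t

/-- The partial order `≼_ii` on Kostant partitions. -/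
def kpLE (C : CartanADE J) {L : ℕ} (ii : Fin L → J) (Λ : J → J → ℚ)
    (m n : (J → ℤ) → ℤ) : Prop :=
  ∀ r : Fin L, rhoOf C ii Λ m r ≤ rhoOf C ii Λ n r

/-- The height function obtained from `ξ` by applying sources `w = [ι₁, …, ι_k]`. -/
noncomputable def heightAfter (σ : Equiv.Perm J) (ξ : J → ℤ) (w : List J) : J → ℤ :=
  w.foldl (fun η ι => fun j => η j - if j = ι then 2 * (orbitSize σ ι : ℤ) else 0) ξ

def IsSource (C : CartanADE J) (ξ : J → ℤ) (ι : J) : Prop :=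
  ∀ j : J, C.a ι j = -1 → ξ j < ξ ι

/-- `ii` is adapted to the Q-datum `(J, σ, ξ)`. -/
def IsAdapted (C : CartanADE J) (D : DiagAut C) (ξ : J → ℤ) {L : ℕ} (ii : Fin L → J) : Prop :=
  ∀ k : Fin L, IsSource C (heightAfter D.σ ξ ((List.ofFn ii).take k.1)) (ii k)

/-- `(s_{ι_{k-1}} ⋯ s_{ι_1} ξ)_{ι_k}`, the second component of `Ω̃_Q(β_k)`. -/
noncomputable def heightAt (σ : Equiv.Perm J) (ξ : J → ℤ) {L : ℕ} (ii : Fin L → J) (k : Fin L) : ℤ :=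
  heightAfter σ ξ ((List.ofFn ii).take k.1) (ii k)

/-- `x ∈ Im Ω̃_Q`. -/
def InImOmega (σ : Equiv.Perm J) (ξ : J → ℤ) {L : ℕ} (ii : Fin L → J) (x : J × ℤ) : Prop :=
  ∃ k : Fin L, ii k = x.1 ∧ heightAt σ ξ ii k = x.2

/-- A single commutation move. -/
def CommStep (C : CartanADE J) {L : ℕ} (ii jj : Fin L → J) : Prop :=
  ∃ (k : ℕ) (h1 : k < L) (h2 : k + 1 < L),
    C.a (ii ⟨k, h1⟩) (ii ⟨k + 1, h2⟩) = 0 ∧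
    jj = ii ∘ Equiv.swap (⟨k, h1⟩ : Fin L) ⟨k + 1, h2⟩

/-- Commutation equivalence of words. -/
def CommEquiv (C : CartanADE J) {L : ℕ} (ii jj : Fin L → J) : Prop :=
  Relation.ReflTransGen (CommStep C) ii jj

/-- The orbits of `ι` and `j` are adjacent (`\barι ∼ \barj` in `I₀`). -/
def adjOrbit (C : CartanADE J) (σ : Equiv.Perm J) (ι j : J) : Prop :=
  ∃ ι' j' : J, SameOrbit σ ι ι' ∧ SameOrbit σ j j' ∧ C.a ι' j' = -1

/-- `c ι j` is the Cartan matrix `c_{\barι \barj}` of the folded algebra `𝔤₀`. -/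
noncomputable def IsFoldedCartan (C : CartanADE J) (σ : Equiv.Perm J) (c : J → J → ℤ) : Prop :=
  ∀ ι j : J, (c ι j : ℚ) =
    if SameOrbit σ ι j then 2
    else if adjOrbit C σ ι j then -(max 1 ((orbitSize σ j : ℚ) / (orbitSize σ ι : ℚ)))
    else 0

/-- The basis element `ϖ_{\barι, p}` of `𝒫_ℤ`, realized as a function on `J × ℤ`
(the indicator of `orbit(ι) × {p}`). -/
noncomputable def varpiF (σ : Equiv.Perm J) (ι : J) (p : ℤ) : (J × ℤ) → ℤ :=
  fun y => if SameOrbit σ ι y.1 ∧ y.2 = p then 1 else 0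

/-- The ℓ-root `α_{\barι, p}`. -/
noncomputable def lrootF (σ : Equiv.Perm J) (c : J → J → ℤ) (ι : J) (p : ℤ) : (J × ℤ) → ℤ :=
  fun y => varpiF σ ι (p + (orbitSize σ ι : ℤ)) y + varpiF σ ι (p - (orbitSize σ ι : ℤ)) y
    - (if (¬ SameOrbit σ ι y.1) ∧
          ∃ k : ℤ, 1 ≤ k ∧ k ≤ -(c y.1 ι) ∧ y.2 = p - c y.1 ι + 1 - 2 * k
       then 1 else 0)

/-- `(\barι, p + 𝗌_{\barι}) ∈ Î₀`, i.e. the index `(\barι,p)` gives a valid ℓ-root. -/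
def ValidLRootIdx (σ : Equiv.Perm J) (ξ : J → ℤ) (ι : J) (p : ℤ) : Prop :=
  (2 : ℤ) ∣ (p + (orbitSize σ ι : ℤ) - ξ ι)

/-- The set of all ℓ-roots (generating `𝒬_ℤ`). -/
noncomputable def lrootSet (σ : Equiv.Perm J) (ξ : J → ℤ) (c : J → J → ℤ) :
    Set ((J × ℤ) → ℤ) :=
  {x | ∃ (ι : J) (p : ℤ), ValidLRootIdx σ ξ ι p ∧ x = lrootF σ c ι p}

/-- The ℤ-linear map `Ω_Q : ℤ^{R⁺} → 𝒫_ℤ`. -/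
noncomputable def OmegaQmap (C : CartanADE J) (σ : Equiv.Perm J) (ξ : J → ℤ) {L : ℕ}
    (ii : Fin L → J) (m : (J → ℤ) → ℤ) : (J × ℤ) → ℤ :=
  ∑ k : Fin L, m (betaOf C ii k) • varpiF σ (ii k) (heightAt σ ξ ii k)

set_option linter.unusedSectionVars false
set_option linter.unusedSimpArgs false


/-! ### Words as lists -/

/-- Firing a vertex, for arbitrary sizes `s`. -/
def fire (s : J → ℕ) (η : J → ℤ) (ι : J) : J → ℤ :=
  fun j => η j - if j = ι then 2 * (s ι : ℤ) else 0

/-- The list of the roots `β_k` of a word. -/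
def betas (C : CartanADE J) : List J → List (J → ℤ)
  | [] => []
  | ι :: u => simpleRoot ι :: (betas C u).map (reflS C ι)

/-- Adaptedness of a list. -/
def AdL (C : CartanADE J) (s : J → ℕ) : (J → ℤ) → List J → Prop
  | _, [] => True
  | η, ι :: u => IsSource C η ι ∧ AdL C s (fire s η ι) u

/-- Heights after firing a list. -/
def hA (s : J → ℕ) (η : J → ℤ) (u : List J) : J → ℤ := u.foldl (fire s) η

def LStep (C : CartanADE J) (u v : List J) : Prop :=
  ∃ (x y : List J) (a b : J), C.a a b = 0 ∧ u = x ++ a :: b :: y ∧ v = x ++ b :: a :: y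

def LComm (C : CartanADE J) (u v : List J) : Prop := Relation.ReflTransGen (LStep C) u v

theorem heightAfter_eq (σ : Equiv.Perm J) (ξ : J → ℤ) (u : List J) :
    heightAfter σ ξ u = hA (orbitSize σ) ξ u := rfl

theorem fire_self (s : J → ℕ) (η : J → ℤ) (ι : J) : fire s η ι ι = η ι - 2 * s ι := by
  simp [fire]

theorem fire_ne (s : J → ℕ) (η : J → ℤ) {ι j : J} (h : j ≠ ι) : fire s η ι j = η j := by
  simp [fire, h]

theorem fire_le (s : J → ℕ) (η : J → ℤ) (ι j : J) : fire s η ι j ≤ η j := by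
  unfold fire; split_ifs <;> simp

theorem fire_comm (s : J → ℕ) (η : J → ℤ) (a b : J) :
    fire s (fire s η a) b = fire s (fire s η b) a := by
  funext j; simp only [fire]; ring

theorem ne_of_adj (C : CartanADE J) {ι j : J} (h : C.a ι j = -1) : ι ≠ j := by
  rintro rfl; rw [C.diag] at h; omega

theorem ne_of_zero (C : CartanADE J) {ι j : J} (h : C.a ι j = 0) : ι ≠ j := by
  rintro rfl; rw [C.diag] at h; omega

theorem AdL_append (C : CartanADE J) (s : J → ℕ) (x y : List J) (η : J → ℤ) :
    AdL C s η (x ++ y) ↔ AdL C s η x ∧ AdL C s (hA s η x) y := by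
  induction x generalizing η with
  | nil => simp [AdL, hA]
  | cons a x ih => simp [AdL, hA, ih, and_assoc]

theorem hA_append (s : J → ℕ) (x y : List J) (η : J → ℤ) :
    hA s η (x ++ y) = hA s (hA s η x) y := by simp [hA]

theorem source_swap (C : CartanADE J) (s : J → ℕ) (η : J → ℤ) {a b : J} (h : C.a a b = 0) :
    IsSource C (fire s η a) b ↔ IsSource C η b := by
  have hab := ne_of_zero C h
  unfold IsSource
  refine forall_congr' fun j => imp_congr_right fun hj => ?_
  have hja : j ≠ a := by rintro rfl; rw [C.symm, h] at hj; omega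
  rw [fire_ne s η hja, fire_ne s η hab.symm]

theorem LStep_AdL (C : CartanADE J) (s : J → ℕ) (η : J → ℤ) {u v : List J} (h : LStep C u v)
    (hu : AdL C s η u) : AdL C s η v := by
  obtain ⟨x, y, a, b, h0, rfl, rfl⟩ := h
  rw [AdL_append] at hu ⊢
  refine ⟨hu.1, ?_⟩
  obtain ⟨_, h1, h2, h3⟩ := hu
  exact ⟨(source_swap C s _ h0).1 h2, (source_swap C s _ (by rw [C.symm]; exact h0)).2 h1,
    by rw [fire_comm]; exact h3⟩

theorem LStep_hA (C : CartanADE J) (s : J → ℕ) (η : J → ℤ) {u v : List J} (h : LStep C u v) :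
    hA s η u = hA s η v := by
  obtain ⟨x, y, a, b, h0, rfl, rfl⟩ := h
  rw [hA_append, hA_append]
  simp only [hA, List.foldl_cons]
  rw [fire_comm]

theorem LStep_symm (C : CartanADE J) {u v : List J} (h : LStep C u v) : LStep C v u := by
  obtain ⟨x, y, a, b, h0, rfl, rfl⟩ := h
  exact ⟨x, y, b, a, by rw [C.symm]; exact h0, rfl, rfl⟩

theorem LComm_symm (C : CartanADE J) {u v : List J} (h : LComm C u v) : LComm C v u := by
  induction h with
  | refl => exact .refl
  | tail _ h2 ih => exact .head (LStep_symm C h2) ih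

theorem LComm_cons (C : CartanADE J) (a : J) {u v : List J} (h : LComm C u v) :
    LComm C (a :: u) (a :: v) := by
  induction h with
  | refl => exact .refl
  | tail _ h2 ih =>
    obtain ⟨x, y, p, q, h0, rfl, rfl⟩ := h2
    exact .tail ih ⟨a :: x, y, p, q, h0, rfl, rfl⟩

theorem LComm_AdL (C : CartanADE J) (s : J → ℕ) (η : J → ℤ) {u v : List J} (h : LComm C u v)
    (hu : AdL C s η u) : AdL C s η v := by
  induction h with
  | refl => exact hu
  | tail _ h2 ih => exact LStep_AdL C s η h2 ih

theorem LComm_hA (C : CartanADE J) (s : J → ℕ) (η : J → ℤ) {u v : List J} (h : LComm C u v) :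
    hA s η u = hA s η v := by
  induction h with
  | refl => rfl
  | tail _ h2 ih => rw [ih, LStep_hA C s η h2]

theorem LComm_length (C : CartanADE J) {u v : List J} (h : LComm C u v) :
    v.length = u.length := by
  induction h with
  | refl => rfl
  | tail _ h2 ih => obtain ⟨x, y, p, q, h0, rfl, rfl⟩ := h2; simpa using ih

theorem pull (C : CartanADE J) (s : J → ℕ) (u : List J) (ι : J) (η : J → ℤ)
    (hu : AdL C s η u) (hι : IsSource C η ι) (hm : ι ∈ u) : ∃ u', LComm C u (ι :: u') := by
  induction u generalizing η with
  | nil => simp at hm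
  | cons κ u ih =>
    by_cases hκ : κ = ι
    · subst hκ; exact ⟨u, .refl⟩
    · have h0 : C.a κ ι = 0 := by
        rcases C.offDiag κ ι hκ with h | h
        · exact h
        · have h1 := hu.1 ι h
          have h2 := hι κ (by rw [C.symm]; exact h)
          omega
      obtain ⟨u', hu'⟩ := ih (fire s η κ) hu.2 ((source_swap C s η h0).2 hι)
        (by rcases List.mem_cons.1 hm with h | h
            · exact absurd h.symm hκ
            · exact h)
      exact ⟨κ :: u', .tail (LComm_cons C κ hu') ⟨[], u', κ, ι, h0, rfl, rfl⟩⟩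

/-! ### The bilinear form and reflections -/

/-- pairing with a simple root -/
theorem reflS_apply (C : CartanADE J) (ι : J) (v : J → ℤ) :
    reflS C ι v = v - (∑ κ, v κ * C.a κ ι) • simpleRoot ι := by
  funext j; simp [reflS]

theorem pairing_simple (C : CartanADE J) (v : J → ℤ) (ι : J) :
    pairing C v (simpleRoot ι) = ∑ κ, v κ * C.a κ ι := by
  simp [pairing, simpleRoot]

theorem pairing_comm (C : CartanADE J) (v w : J → ℤ) : pairing C v w = pairing C w v := by
  unfold pairing
  rw [Finset.sum_comm]
  refine Finset.sum_congr rfl fun i _ => Finset.sum_congr rfl fun j _ => ?_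
  rw [C.symm]; ring

theorem pairing_sub_left (C : CartanADE J) (v w x : J → ℤ) :
    pairing C (v - w) x = pairing C v x - pairing C w x := by
  simp [pairing, sub_mul, Finset.sum_sub_distrib]

theorem pairing_add_left (C : CartanADE J) (v w x : J → ℤ) :
    pairing C (v + w) x = pairing C v x + pairing C w x := by
  simp [pairing, add_mul, Finset.sum_add_distrib]

theorem pairing_smul_left (C : CartanADE J) (c : ℤ) (w x : J → ℤ) :
    pairing C (c • w) x = c * pairing C w x := by
  simp [pairing, Finset.mul_sum, mul_assoc]

theorem pairing_neg_left (C : CartanADE J) (w x : J → ℤ) :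
    pairing C (-w) x = - pairing C w x := by
  simp [pairing]

theorem pairing_sub_right (C : CartanADE J) (v w x : J → ℤ) :
    pairing C x (v - w) = pairing C x v - pairing C x w := by
  rw [pairing_comm, pairing_sub_left, pairing_comm C v, pairing_comm C w]

theorem pairing_neg_right (C : CartanADE J) (w x : J → ℤ) :
    pairing C x (-w) = - pairing C x w := by
  rw [pairing_comm, pairing_neg_left, pairing_comm]

theorem pairing_smul_right (C : CartanADE J) (c : ℤ) (w x : J → ℤ) :
    pairing C x (c • w) = c * pairing C x w := by
  rw [pairing_comm, pairing_smul_left, pairing_comm]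

theorem pairing_simple_simple (C : CartanADE J) (ι j : J) :
    pairing C (simpleRoot ι) (simpleRoot j) = C.a ι j := by
  rw [pairing_simple]; simp [simpleRoot]

theorem refl_eq (C : CartanADE J) (ι : J) (v : J → ℤ) :
    reflS C ι v = v - pairing C v (simpleRoot ι) • simpleRoot ι := by
  rw [reflS_apply, pairing_simple]

theorem refl_isom (C : CartanADE J) (ι : J) (v w : J → ℤ) :
    pairing C (reflS C ι v) (reflS C ι w) = pairing C v w := by
  simp only [refl_eq, pairing_sub_left, pairing_sub_right, pairing_smul_left, pairing_smul_right,
    pairing_simple_simple, C.diag, pairing_comm C (simpleRoot ι) w]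
  ring

theorem refl_invol (C : CartanADE J) (ι : J) (v : J → ℤ) : reflS C ι (reflS C ι v) = v := by
  rw [refl_eq C ι (reflS C ι v), refl_eq C ι v]
  simp only [pairing_sub_left, pairing_smul_left, pairing_simple_simple, C.diag]
  module

theorem refl_neg (C : CartanADE J) (ι : J) (v : J → ℤ) : reflS C ι (-v) = - reflS C ι v := by
  simp only [refl_eq, pairing_neg_left]; module

theorem refl_add (C : CartanADE J) (ι : J) (v w : J → ℤ) :
    reflS C ι (v + w) = reflS C ι v + reflS C ι w := by
  simp only [refl_eq, pairing_add_left]; module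

theorem refl_smul (C : CartanADE J) (ι : J) (c : ℤ) (w : J → ℤ) :
    reflS C ι (c • w) = c • reflS C ι w := by
  simp only [refl_eq, pairing_smul_left]; module

theorem refl_simple (C : CartanADE J) (ι : J) : reflS C ι (simpleRoot ι) = - simpleRoot ι := by
  simp only [refl_eq, pairing_simple_simple, C.diag]; module

theorem refl_ne (C : CartanADE J) {ι j : J} (h : j ≠ ι) (v : J → ℤ) : reflS C ι v j = v j := by
  simp [reflS, simpleRoot, h]

theorem refl_comm (C : CartanADE J) {a b : J} (h : C.a a b = 0) (v : J → ℤ) :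
    reflS C a (reflS C b v) = reflS C b (reflS C a v) := by
  have h' : C.a b a = 0 := by rw [C.symm]; exact h
  simp only [refl_eq, pairing_sub_left, pairing_smul_left, pairing_simple_simple, h, h']
  module

theorem refl_simple_zero (C : CartanADE J) {a b : J} (h : C.a a b = 0) :
    reflS C a (simpleRoot b) = simpleRoot b := by
  have h' : C.a b a = 0 := by rw [C.symm]; exact h
  simp only [refl_eq, pairing_simple_simple, h']
  module

/-- words acting on the lattice -/
abbrev act (C : CartanADE J) (u : List J) (v : J → ℤ) : J → ℤ := applyRefls C u v

theorem act_nil (C : CartanADE J) (v : J → ℤ) : act C [] v = v := rfl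
theorem act_cons (C : CartanADE J) (ι : J) (u : List J) (v : J → ℤ) :
    act C (ι :: u) v = reflS C ι (act C u v) := rfl
theorem act_append (C : CartanADE J) (u w : List J) (v : J → ℤ) :
    act C (u ++ w) v = act C u (act C w v) := by simp [applyRefls]
theorem act_isom (C : CartanADE J) (u : List J) (v w : J → ℤ) :
    pairing C (act C u v) (act C u w) = pairing C v w := by
  induction u with
  | nil => rfl
  | cons a u ih => rw [act_cons, act_cons, refl_isom, ih]
theorem act_neg (C : CartanADE J) (u : List J) (v : J → ℤ) : act C u (-v) = - act C u v := by
  induction u with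
  | nil => rfl
  | cons a u ih => rw [act_cons, act_cons, ih, refl_neg]
theorem act_add (C : CartanADE J) (u : List J) (v w : J → ℤ) :
    act C u (v + w) = act C u v + act C u w := by
  induction u with
  | nil => rfl
  | cons a u ih => rw [act_cons, act_cons, act_cons, ih, refl_add]
theorem act_smul (C : CartanADE J) (u : List J) (c : ℤ) (w : J → ℤ) :
    act C u (c • w) = c • act C u w := by
  induction u with
  | nil => rfl
  | cons a u ih => rw [act_cons, act_cons, ih, refl_smul]

/-- the action as a linear map -/
def actL (C : CartanADE J) (u : List J) : (J → ℤ) →ₗ[ℤ] (J → ℤ) where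
  toFun := act C u
  map_add' := act_add C u
  map_smul' := act_smul C u

theorem act_reverse (C : CartanADE J) (u : List J) (v : J → ℤ) :
    act C u.reverse (act C u v) = v := by
  induction u generalizing v with
  | nil => rfl
  | cons a u ih => rw [List.reverse_cons, act_append, act_cons, act_cons, act_nil, refl_invol, ih]

theorem act_reverse' (C : CartanADE J) (u : List J) (v : J → ℤ) :
    act C u (act C u.reverse v) = v := by
  conv_lhs => rw [← List.reverse_reverse u]
  simpa using act_reverse C u.reverse v

theorem vec_eq_sum (v : J → ℤ) : v = ∑ ι, v ι • simpleRoot ι := by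
  funext j; simp [simpleRoot, Finset.sum_apply]

/-! ### betas -/

theorem betas_append (C : CartanADE J) (u w : List J) :
    betas C (u ++ w) = betas C u ++ (betas C w).map (act C u) := by
  induction u with
  | nil =>
    rw [show act C [] = id from rfl]; simp [betas]
  | cons a u ih =>
    simp only [List.cons_append, betas, ih, List.map_append, List.map_map]
    rfl

theorem betas_length (C : CartanADE J) (u : List J) : (betas C u).length = u.length := by
  induction u with
  | nil => rfl
  | cons a u ih => simp [betas, ih]

theorem betas_getElem (C : CartanADE J) (u : List J) (k : ℕ) (h : k < u.length) :
    (betas C u)[k]'(by rw [betas_length]; exact h) = act C (u.take k) (simpleRoot u[k]) := by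
  induction u generalizing k with
  | nil => simp at h
  | cons a u ih =>
    cases k with
    | zero => rfl
    | succ k => simp only [betas, List.getElem_cons_succ, List.getElem_map, List.take_succ_cons,
        act_cons]; rw [ih]

theorem betas_ofFn (C : CartanADE J) {L : ℕ} (ii : Fin L → J) :
    betas C (List.ofFn ii) = List.ofFn (betaOf C ii) := by
  apply List.ext_getElem
  · simp [betas_length]
  · intro k h1 h2
    rw [betas_getElem C _ k (by simpa [betas_length] using h1)]
    simp [betaOf]

theorem LStep_betas (C : CartanADE J) {u v : List J} (h : LStep C u v) :
    (betas C u).Perm (betas C v) := by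
  obtain ⟨x, y, a, b, h0, rfl, rfl⟩ := h
  rw [betas_append, betas_append]
  refine List.Perm.append_left _ (List.Perm.map _ ?_)
  simp only [betas, List.map_cons, List.map_map]
  rw [refl_simple_zero C h0, refl_simple_zero C (by rw [C.symm]; exact h0),
    show reflS C a ∘ reflS C b = reflS C b ∘ reflS C a from funext (refl_comm C h0)]
  exact List.Perm.swap _ _ _

theorem LStep_act (C : CartanADE J) {u v : List J} (h : LStep C u v) (z : J → ℤ) :
    act C u z = act C v z := by
  obtain ⟨x, y, a, b, h0, rfl, rfl⟩ := h
  rw [act_append, act_append, act_cons, act_cons, act_cons, act_cons, refl_comm C h0]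

theorem LComm_betas (C : CartanADE J) {u v : List J} (h : LComm C u v) :
    (betas C u).Perm (betas C v) := by
  induction h with
  | refl => exact .refl _
  | tail _ h2 ih => exact ih.trans (LStep_betas C h2)

theorem LComm_act (C : CartanADE J) {u v : List J} (h : LComm C u v) (z : J → ℤ) :
    act C u z = act C v z := by
  induction h with
  | refl => rfl
  | tail _ h2 ih => rw [ih, LStep_act C h2]

theorem betas_zero (C : CartanADE J) (u : List J) (ι : J) (h : ι ∉ u) :
    ∀ β ∈ betas C u, β ι = 0 := by
  induction u with
  | nil => simp [betas]
  | cons a u ih =>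
    simp only [List.mem_cons, not_or] at h
    intro β hβ
    simp only [betas, List.mem_cons, List.mem_map] at hβ
    rcases hβ with rfl | ⟨γ, hγ, rfl⟩
    · simp [simpleRoot, h.1]
    · rw [refl_ne C h.1]; exact ih h.2 γ hγ

theorem mem_of_simple (C : CartanADE J) (u : List J) (ι : J) (h : simpleRoot ι ∈ betas C u) :
    ι ∈ u := by
  by_contra hn
  have := betas_zero C u ι hn _ h
  simp [simpleRoot] at this

/-- two adapted words with the same roots are commutation equivalent -/
theorem comm_of_perm (C : CartanADE J) (s : J → ℕ) (v u : List J) (η : J → ℤ)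
    (hu : AdL C s η u) (hv : AdL C s η v) (hp : (betas C u).Perm (betas C v)) : LComm C u v := by
  induction v generalizing u η with
  | nil =>
    have := hp.length_eq
    rw [betas_length, betas_length] at this
    rw [List.length_eq_zero_iff.1 this]; exact .refl
  | cons ι v ih =>
    have hm : simpleRoot ι ∈ betas C u := hp.mem_iff.2 (by simp [betas])
    obtain ⟨u', hu'⟩ := pull C s u ι η hu hv.1 (mem_of_simple C u ι hm)
    have hp' := (LComm_betas C hu').symm.trans hp
    simp only [betas, List.perm_cons] at hp'
    have h3 := hp'.map (reflS C ι)
    simp only [List.map_map] at h3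
    rw [show reflS C ι ∘ reflS C ι = id from funext (refl_invol C ι)] at h3
    simp only [List.map_id] at h3
    exact hu'.trans (LComm_cons C ι (ih u' _ (LComm_AdL C s η hu' hu).2 hv.2 h3))

/-! ### Conversions -/

theorem AdL_iff (C : CartanADE J) (s : J → ℕ) (u : List J) (η : J → ℤ) :
    AdL C s η u ↔ ∀ (k : ℕ) (h : k < u.length), IsSource C (hA s η (u.take k)) u[k] := by
  induction u generalizing η with
  | nil => simp [AdL]
  | cons a u ih =>
    simp only [AdL, ih]
    constructor
    · rintro ⟨h1, h2⟩ k hk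
      cases k with
      | zero => exact h1
      | succ k => exact h2 k (by simpa using hk)
    · intro h
      exact ⟨h 0 (by simp), fun k hk => h (k + 1) (by simpa using hk)⟩

theorem IsAdapted_iff (C : CartanADE J) (D : DiagAut C) (ξ : J → ℤ) {L : ℕ} (ii : Fin L → J) :
    IsAdapted C D ξ ii ↔ AdL C (orbitSize D.σ) ξ (List.ofFn ii) := by
  rw [AdL_iff]
  constructor
  · intro h k hk
    have := h ⟨k, by simpa using hk⟩
    rw [heightAfter_eq] at this
    simpa using this
  · intro h k
    have := h k.1 (by simp)
    rw [heightAfter_eq]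
    simpa using this

theorem CommStep_iff (C : CartanADE J) {L : ℕ} (ii jj : Fin L → J) :
    CommStep C ii jj ↔ LStep C (List.ofFn ii) (List.ofFn jj) := by
  constructor
  · rintro ⟨k, h1, h2, h0, rfl⟩
    refine ⟨(List.ofFn ii).take k, (List.ofFn ii).drop (k + 2), _, _, h0, ?_, ?_⟩
    · apply List.ext_getElem
      · simp; omega
      · intro n hn hn'
        simp only [List.getElem_append, List.length_take, List.length_ofFn, List.getElem_ofFn,
          List.getElem_take, List.getElem_cons, List.getElem_drop]
        simp only [min_eq_left h1.le]
        split_ifs <;> first | rfl | (congr 2; omega)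
    · apply List.ext_getElem
      · simp; omega
      · intro n hn hn'
        simp only [List.getElem_append, List.length_take, List.length_ofFn, List.getElem_ofFn,
          List.getElem_take, List.getElem_cons, List.getElem_drop, Function.comp,
          Equiv.swap_apply_def, Fin.mk.injEq]
        simp only [min_eq_left h1.le]
        split_ifs <;> first | rfl | (exfalso; omega) | (congr 2; omega)
  · rintro ⟨x, y, a, b, h0, hu, hv⟩
    have hL : L = x.length + (y.length + 1 + 1) := by
      have := congrArg List.length hu; simpa using this
    have hi : ∀ n (hn : n < L), ii ⟨n, hn⟩ = (x ++ a :: b :: y)[n]'(by simp; omega) := by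
      intro n hn; simp only [← hu]; simp
    have hj : ∀ n (hn : n < L), jj ⟨n, hn⟩ = (x ++ b :: a :: y)[n]'(by simp; omega) := by
      intro n hn; simp only [← hv]; simp
    refine ⟨x.length, by omega, by omega, ?_, ?_⟩
    · rw [hi, hi]; simpa using h0
    · funext n
      obtain ⟨n, hn⟩ := n
      rw [hj]
      simp only [Function.comp, Equiv.swap_apply_def, Fin.mk.injEq]
      split_ifs with h1 h2
      · subst h1; rw [hi]; simp
      · subst h2; rw [hi]; simp
      · rw [hi]
        simp only [List.getElem_append, List.getElem_cons]
        split_ifs <;> first | rfl | (exfalso; omega)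

theorem CommEquiv_of_LComm (C : CartanADE J) {L : ℕ} (ii : Fin L → J) (v : List J)
    (h : LComm C (List.ofFn ii) v) : ∀ jj : Fin L → J, v = List.ofFn jj → CommEquiv C ii jj := by
  induction h with
  | refl =>
    intro jj hj
    rw [List.ofFn_injective hj]; exact .refl
  | @tail b c h1 h2 ih =>
    rintro jj rfl
    have hl := LComm_length C h1
    simp at hl
    have hb : b = List.ofFn (fun i : Fin L => b[i.1]) := by
      apply List.ext_getElem
      · simp [hl]
      · intro n _ _; simp
    have := ih _ hb
    rw [hb] at h2
    exact .tail this ((CommStep_iff C _ _).2 h2)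

theorem part3 (C : CartanADE J) (D : DiagAut C) (ξ : J → ℤ) {L : ℕ} (ii jj : Fin L → J)
    (h : IsAdapted C D ξ ii) (hc : CommEquiv C ii jj) : IsAdapted C D ξ jj := by
  induction hc with
  | refl => exact h
  | tail _ h2 ih =>
    rw [IsAdapted_iff] at ih ⊢
    exact LStep_AdL C _ _ ((CommStep_iff C _ _).1 h2) ih

theorem part2 (C : CartanADE J) (D : DiagAut C) (ξ : J → ℤ) {L : ℕ} (ii jj : Fin L → J)
    (hi : IsReducedWord C ii) (hi' : IsAdapted C D ξ ii)
    (hj : IsReducedWord C jj) (hj' : IsAdapted C D ξ jj) : CommEquiv C ii jj := by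
  rw [IsAdapted_iff] at hi' hj'
  refine CommEquiv_of_LComm C ii _ (comm_of_perm C _ _ _ ξ hi' hj' ?_) jj rfl
  rcases Nat.eq_zero_or_pos L with rfl | hL
  · simp [betas]
  · have hfin : (posRoots C).Finite := Set.finite_of_ncard_ne_zero (by rw [← hi.1]; omega)
    have key : ∀ kk : Fin L → J, IsReducedWord C kk → Set.range (betaOf C kk) = posRoots C := by
      intro kk hk
      apply Set.eq_of_subset_of_ncard_le _ _ hfin
      · rintro _ ⟨k, rfl⟩; exact hk.2.2 k
      · rw [← Set.image_univ, Set.ncard_image_of_injective _ hk.2.1, Set.ncard_univ, ← hk.1]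
        simp
    rw [betas_ofFn, betas_ofFn, List.perm_ext_iff_of_nodup (List.nodup_ofFn.2 hi.2.1)
      (List.nodup_ofFn.2 hj.2.1)]
    intro β
    rw [List.mem_ofFn', List.mem_ofFn', key ii hi, key jj hj]


/-! ### Roots -/

theorem pairing_pos (C : CartanADE J) (v : J → ℤ) (hv : v ≠ 0) : 0 < pairing C v v := by
  have h := C.posDef (fun i => (v i : ℚ)) (by
    intro h; apply hv; funext i; have := congrFun h i; simpa using this)
  have : ((pairing C v v : ℤ) : ℚ) = ∑ ι : J, ∑ j : J, (v ι : ℚ) * (C.a ι j : ℚ) * (v j : ℚ) := by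
    simp [pairing]
  rw [← this] at h
  exact_mod_cast h

theorem pairing_even (C : CartanADE J) (v : J → ℤ) : Even (pairing C v v) := by
  rw [vec_eq_sum v]
  generalize (Finset.univ : Finset J) = S
  induction S using Finset.induction_on with
  | empty => simp [pairing]
  | insert a S ha ih =>
    rw [Finset.sum_insert ha]
    generalize ∑ x ∈ S, v x • simpleRoot x = w at *
    rw [pairing_add_left, pairing_comm C _ (_ + w), pairing_comm C w (_ + w), pairing_add_left,
      pairing_add_left, pairing_comm C w (v a • simpleRoot a), pairing_smul_left,
      pairing_smul_right, pairing_simple_simple, C.diag]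
    obtain ⟨k, hk⟩ := ih
    rw [hk]
    exact ⟨v a * v a + pairing C (v a • simpleRoot a) w + k, by ring⟩

theorem root_sign (C : CartanADE J) (v : J → ℤ) (hv : pairing C v v = 2) :
    (∀ ι, 0 ≤ v ι) ∨ (∀ ι, v ι ≤ 0) := by
  by_contra hcon
  push Not at hcon
  obtain ⟨⟨i, hi⟩, j, hj⟩ := hcon
  set p : J → ℤ := fun i => max (v i) 0 with hp
  set n : J → ℤ := fun i => max (-v i) 0 with hn
  have hvp : v = p - n := by
    funext k; simp only [hp, hn, Pi.sub_apply]
    rcases le_total (v k) 0 with h | h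
    · rw [max_eq_right h, max_eq_left (by omega)]; ring
    · rw [max_eq_left h, max_eq_right (by omega)]; ring
  have hp0 : p ≠ 0 := by
    intro h; have := congrFun h j; simp only [hp, Pi.zero_apply] at this
    have := le_max_left (v j) 0; omega
  have hn0 : n ≠ 0 := by
    intro h; have := congrFun h i; simp only [hn, Pi.zero_apply] at this
    have := le_max_left (-v i) 0; omega
  have h1 := pairing_pos C p hp0
  have h2 := pairing_pos C n hn0
  obtain ⟨a, ha⟩ := pairing_even C p
  obtain ⟨b, hb⟩ := pairing_even C n
  have h3 : pairing C p n ≤ 0 := by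
    unfold pairing
    refine Finset.sum_nonpos fun k _ => Finset.sum_nonpos fun l _ => ?_
    by_cases hkl : k = l
    · subst hkl
      have : p k * n k = 0 := by
        simp only [hp, hn]
        rcases le_total (v k) 0 with h | h
        · rw [max_eq_right h]; ring
        · rw [max_eq_right (a := -v k) (by omega)]; ring
      rw [mul_right_comm, this]; simp
    · have hpk : 0 ≤ p k := le_max_right _ _
      have hnl : 0 ≤ n l := le_max_right _ _
      have := mul_nonneg hpk hnl
      rcases C.offDiag k l hkl with h | h <;> rw [h] <;> nlinarith
  have h4 : pairing C v v = pairing C p p + pairing C n n - 2 * pairing C p n := by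
    rw [hvp, pairing_sub_left, pairing_sub_right, pairing_sub_right, pairing_comm C n p]; ring
  omega

theorem root_ne_zero (C : CartanADE J) (v : J → ℤ) (hv : pairing C v v = 2) : v ≠ 0 := by
  rintro rfl; simp [pairing] at hv

theorem pos_or_neg (C : CartanADE J) (v : J → ℤ) (hv : pairing C v v = 2) :
    v ∈ posRoots C ∨ -v ∈ posRoots C := by
  have h0 := root_ne_zero C v hv
  rcases root_sign C v hv with h | h
  · exact Or.inl ⟨h, h0, hv⟩
  · refine Or.inr ⟨fun ι => by have := h ι; simp; omega, neg_ne_zero.2 h0, ?_⟩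
    rw [pairing_neg_left, pairing_neg_right, neg_neg, hv]

theorem not_pos_neg (C : CartanADE J) (v : J → ℤ) (h1 : v ∈ posRoots C) (h2 : -v ∈ posRoots C) :
    False := by
  apply h1.2.1
  funext ι
  have a := h1.1 ι
  have b := h2.1 ι
  simp at b ⊢
  omega

theorem simple_mem (C : CartanADE J) (ι : J) : simpleRoot ι ∈ posRoots C := by
  have h : pairing C (simpleRoot ι) (simpleRoot ι) = 2 := by rw [pairing_simple_simple, C.diag]
  refine ⟨fun j => ?_, root_ne_zero C _ h, h⟩
  unfold simpleRoot; split_ifs <;> simp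

theorem refl_pos (C : CartanADE J) (ι : J) (β : J → ℤ) (hβ : β ∈ posRoots C)
    (hne : β ≠ simpleRoot ι) : reflS C ι β ∈ posRoots C := by
  have hr : pairing C (reflS C ι β) (reflS C ι β) = 2 := by rw [refl_isom]; exact hβ.2.2
  by_cases hex : ∃ j, j ≠ ι ∧ β j ≠ 0
  · obtain ⟨j, hj, hj0⟩ := hex
    rcases pos_or_neg C _ hr with h | h
    · exact h
    · exfalso
      have h1 := h.1 j
      have h2 := hβ.1 j
      rw [Pi.neg_apply, refl_ne C hj] at h1
      omega
  · exfalso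
    push Not at hex
    have hb : β = β ι • simpleRoot ι := by
      funext j
      by_cases h : j = ι
      · subst h; simp [simpleRoot]
      · rw [hex j h]; simp [simpleRoot, h]
    have h2 := hβ.2.2
    rw [hb, pairing_smul_left, pairing_smul_right, pairing_simple_simple, C.diag] at h2
    have h3 := hβ.1 ι
    have h4 : β ι = 1 := by nlinarith
    rw [h4, one_smul] at hb
    exact hne hb

theorem inv_or (C : CartanADE J) (u : List J) (β : J → ℤ) (hβ : β ∈ posRoots C) :
    β ∈ betas C u ∨ act C u.reverse β ∈ posRoots C := by
  induction u generalizing β with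
  | nil => exact Or.inr hβ
  | cons ι u ih =>
    by_cases h : β = simpleRoot ι
    · left; simp [betas, h]
    · rcases ih _ (refl_pos C ι β hβ h) with h1 | h1
      · left
        simp only [betas, List.mem_cons, List.mem_map]
        exact Or.inr ⟨_, h1, refl_invol C ι β⟩
      · right
        rw [List.reverse_cons, act_append]
        exact h1

theorem inv_neg (C : CartanADE J) (u : List J) (h : ∀ β ∈ betas C u, β ∈ posRoots C) :
    ∀ β ∈ betas C u, -(act C u.reverse β) ∈ posRoots C := by
  induction u using List.reverseRecOn with
  | nil => simp [betas]
  | append_singleton u κ ih =>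
    rw [betas_append] at h ⊢
    simp only [betas, List.map_cons, List.map_nil, List.mem_append, List.mem_singleton] at h ⊢
    have ih' := ih fun β hβ => h β (Or.inl hβ)
    rintro β (hβ | rfl)
    · rw [List.reverse_append, act_append, ← act_neg]
      change reflS C κ (-(act C u.reverse β)) ∈ posRoots C
      rw [← act_neg]
      apply refl_pos
      · rw [act_neg]; exact ih' β hβ
      · intro he
        have : act C u (simpleRoot κ) = - β := by rw [← he, act_reverse']
        have h2 := h _ (Or.inr rfl)
        rw [this] at h2
        exact not_pos_neg C β (h β (Or.inl hβ)) h2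
    · rw [List.reverse_append, act_append, act_reverse]
      change -(reflS C κ (simpleRoot κ)) ∈ posRoots C
      rw [refl_simple, neg_neg]
      exact simple_mem C κ

theorem betas_nodup (C : CartanADE J) (u : List J) (h : ∀ β ∈ betas C u, β ∈ posRoots C) :
    (betas C u).Nodup := by
  induction u using List.reverseRecOn with
  | nil => simp [betas]
  | append_singleton u κ ih =>
    rw [betas_append] at h ⊢
    simp only [betas, List.map_cons, List.map_nil, List.mem_append, List.mem_singleton] at h ⊢
    have h' : ∀ β ∈ betas C u, β ∈ posRoots C := fun β hβ => h β (Or.inl hβ)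
    rw [List.nodup_append]
    refine ⟨ih h', by simp, ?_⟩
    intro a ha b hb
    rw [List.mem_singleton] at hb
    rintro rfl
    have h1 := inv_neg C u h' a ha
    rw [hb, act_reverse] at h1
    exact not_pos_neg C _ (simple_mem C κ) h1

/-- the word sends all simple roots to negative roots -/
def AllNeg (C : CartanADE J) (u : List J) : Prop :=
  ∀ ι, -(act C u (simpleRoot ι)) ∈ posRoots C

theorem allneg_pos (C : CartanADE J) (u : List J) (h : AllNeg C u) (β : J → ℤ)
    (hβ : β ∈ posRoots C) : -(act C u β) ∈ posRoots C := by
  have hr : pairing C (-(act C u β)) (-(act C u β)) = 2 := by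
    rw [pairing_neg_left, pairing_neg_right, neg_neg, act_isom]; exact hβ.2.2
  refine ⟨?_, root_ne_zero C _ hr, hr⟩
  intro κ
  have h1 : act C u β = ∑ ι, β ι • act C u (simpleRoot ι) := by
    conv_lhs => rw [vec_eq_sum β]
    change actL C u _ = _
    rw [map_sum]
    refine Finset.sum_congr rfl fun i _ => ?_
    rw [map_smul]; rfl
  rw [h1, Pi.neg_apply, Finset.sum_apply, ← Finset.sum_neg_distrib]
  refine Finset.sum_nonneg fun ι _ => ?_
  have h2 := (h ι).1 κ
  have h3 := hβ.1 ι
  simp only [Pi.neg_apply, Pi.smul_apply, smul_eq_mul] at h2 ⊢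
  nlinarith

theorem allneg_full (C : CartanADE J) (u : List J) (h : AllNeg C u) (β : J → ℤ)
    (hβ : β ∈ posRoots C) : β ∈ betas C u := by
  rcases inv_or C u β hβ with h1 | h1
  · exact h1
  · exfalso
    have h2 := allneg_pos C u h _ h1
    rw [act_reverse'] at h2
    exact not_pos_neg C β hβ h2

/-- reduced words for the longest element, on lists -/
def Red (C : CartanADE J) (u : List J) : Prop :=
  (∀ β ∈ betas C u, β ∈ posRoots C) ∧ AllNeg C u

theorem Red_ncard (C : CartanADE J) (u : List J) (h : Red C u) :
    (posRoots C).ncard = u.length := by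
  have h1 : posRoots C = ((betas C u).toFinset : Set (J → ℤ)) := by
    ext β
    simp only [List.coe_toFinset, Set.mem_ofPred_eq]
    exact ⟨allneg_full C u h.2 β, h.1 β⟩
  rw [h1, Set.ncard_coe_finset, List.toFinset_card_of_nodup (betas_nodup C u h.1), betas_length]

theorem Red_word (C : CartanADE J) (D : DiagAut C) (ξ : J → ℤ) (u : List J) (h : Red C u)
    (ha : AdL C (orbitSize D.σ) ξ u) :
    ∃ ii : Fin ((posRoots C).ncard) → J, IsReducedWord C ii ∧ IsAdapted C D ξ ii := by
  have hn := Red_ncard C u h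
  refine ⟨fun k => u[k.1]'(by rw [← hn]; exact k.2), ?_⟩
  have hu : List.ofFn (fun k : Fin ((posRoots C).ncard) => u[k.1]'(by rw [← hn]; exact k.2)) = u := by
    apply List.ext_getElem
    · simp [hn]
    · intro n _ _; simp
  have hb := betas_ofFn C (fun k : Fin ((posRoots C).ncard) => u[k.1]'(by rw [← hn]; exact k.2))
  rw [hu] at hb
  refine ⟨⟨rfl, ?_, ?_⟩, ?_⟩
  · rw [← List.nodup_ofFn, ← hb]; exact betas_nodup C u h.1
  · intro k
    apply h.1
    rw [hb, List.mem_ofFn']; exact ⟨k, rfl⟩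
  · rw [IsAdapted_iff, hu]; exact ha


/-! ### Orbit sizes -/

theorem orbitSize_eq (σ : Equiv.Perm J) (ι : J) :
    orbitSize σ ι = Function.minimalPeriod σ ι := by
  unfold orbitSize
  have hper : Function.IsPeriodicPt σ (orderOf σ) ι := by
    rw [Function.IsPeriodicPt, Function.IsFixedPt, Equiv.Perm.iterate_eq_pow, pow_orderOf_eq_one]
    rfl
  have hr : 0 < orderOf σ := orderOf_pos σ
  have hd := hper.minimalPeriod_dvd
  have hp : 0 < Function.minimalPeriod σ ι := Nat.pos_of_dvd_of_pos hd hr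
  have : ((Finset.range (orderOf σ)).image fun k => (σ ^ k) ι) =
      (Finset.range (Function.minimalPeriod σ ι)).image fun k => (σ ^ k) ι := by
    ext x
    simp only [Finset.mem_image, Finset.mem_range]
    constructor
    · rintro ⟨k, _, rfl⟩
      refine ⟨k % Function.minimalPeriod σ ι, Nat.mod_lt _ hp, ?_⟩
      rw [← Equiv.Perm.iterate_eq_pow, ← Equiv.Perm.iterate_eq_pow,
        Function.iterate_mod_minimalPeriod_eq]
    · rintro ⟨k, hk, rfl⟩
      exact ⟨k, lt_of_lt_of_le hk (Nat.le_of_dvd hr hd), rfl⟩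
  rw [this, Finset.card_image_of_injOn, Finset.card_range]
  intro a ha b hb hab
  apply Function.iterate_injOn_Iio_minimalPeriod (f := σ) (x := ι)
  · simpa using ha
  · simpa using hb
  · simpa [Equiv.Perm.iterate_eq_pow] using hab

theorem pow_fix_iff (σ : Equiv.Perm J) (ι : J) (m : ℕ) :
    (σ ^ m) ι = ι ↔ orbitSize σ ι ∣ m := by
  rw [orbitSize_eq, ← Equiv.Perm.iterate_eq_pow]
  exact Function.isPeriodicPt_iff_minimalPeriod_dvd

theorem orbitSize_pow (σ : Equiv.Perm J) (ι : J) (k : ℕ) :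
    orbitSize σ ((σ ^ k) ι) = orbitSize σ ι := by
  have key : ∀ m, (σ ^ m) ((σ ^ k) ι) = (σ ^ k) ι ↔ (σ ^ m) ι = ι := by
    intro m
    rw [← Equiv.Perm.mul_apply, ← pow_add, add_comm, pow_add, Equiv.Perm.mul_apply]
    exact (σ ^ k).injective.eq_iff
  apply Nat.dvd_antisymm
  · rw [← pow_fix_iff, key, pow_fix_iff]
  · rw [← pow_fix_iff, ← key, pow_fix_iff]

theorem orbitSize_dvd (σ : Equiv.Perm J) (ι : J) : orbitSize σ ι ∣ orderOf σ := by
  rw [← pow_fix_iff, pow_orderOf_eq_one]; rfl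

theorem orbitSize_pos (σ : Equiv.Perm J) (ι : J) : 0 < orbitSize σ ι :=
  Nat.pos_of_dvd_of_pos (orbitSize_dvd σ ι) (orderOf_pos σ)

/-! ### The Dynkin graph is a tree -/

theorem noCyc (C : CartanADE J) (S : Finset J) (hS : S.Nonempty)
    (h : ∀ v ∈ S, ∃ w1 ∈ S, ∃ w2 ∈ S, w1 ≠ w2 ∧ C.a v w1 = -1 ∧ C.a v w2 = -1) : False := by
  have hp := pairing_pos C (fun i => if i ∈ S then 1 else 0) (by
    intro h0; obtain ⟨x, hx⟩ := hS; have := congrFun h0 x; simp [hx] at this)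
  have : pairing C (fun i => if i ∈ S then 1 else 0) (fun i => if i ∈ S then 1 else 0)
      = ∑ v ∈ S, ∑ w ∈ S, C.a v w := by
    unfold pairing
    simp only [ite_mul, one_mul, zero_mul, mul_ite, mul_one, mul_zero]
    simp [Finset.sum_ite_mem]
  rw [this] at hp
  refine absurd hp (not_lt.mpr (Finset.sum_nonpos fun v hv => ?_))
  obtain ⟨w1, h1, w2, h2, hne, a1, a2⟩ := h v hv
  have n1 := ne_of_adj C a1
  have n2 := ne_of_adj C a2
  have e1 : (∑ w ∈ ({v, w1, w2} : Finset J), C.a v w) = 0 := by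
    rw [Finset.sum_insert, Finset.sum_pair hne, C.diag, a1, a2]; · rfl
    simp [n1, n2]
  have hsub : ({v, w1, w2} : Finset J) ⊆ S := by
    intro x hx; simp at hx; rcases hx with rfl | rfl | rfl <;> assumption
  rw [← Finset.sum_sdiff hsub, e1, add_zero]
  refine Finset.sum_nonpos fun w hw => ?_
  have : v ≠ w := by rintro rfl; simp at hw
  rcases C.offDiag v w this with h | h <;> omega

/-- The Dynkin graph. -/
def dG (C : CartanADE J) : SimpleGraph J where
  Adj ι j := C.a ι j = -1
  symm := ⟨fun ι j h => by rw [C.symm]; exact h⟩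
  loopless := ⟨fun ι h => ne_of_adj C h rfl⟩

theorem dG_adj (C : CartanADE J) (ι j : J) : (dG C).Adj ι j ↔ C.a ι j = -1 := Iff.rfl

theorem dG_conn (C : CartanADE J) (x y : J) : (dG C).Reachable x y := by
  have := C.indec {z | (dG C).Reachable x z} ⟨x, SimpleGraph.Reachable.refl x⟩ (by
    intro ι hι j hj
    exact SimpleGraph.Reachable.trans hι (SimpleGraph.Adj.reachable hj))
  have h2 : y ∈ (Set.univ : Set J) := trivial
  rw [← this] at h2; exact h2

theorem dG_acyc (C : CartanADE J) : (dG C).IsAcyclic := by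
  intro v p hp
  refine noCyc C p.support.toFinset ⟨v, by simp⟩ ?_
  intro x hx
  have hx' : x ∈ p.support := by simpa using hx
  have := hp.ncard_neighborSet_toSubgraph_eq_two hx'
  have h2 : 1 < (p.toSubgraph.neighborSet x).ncard := by omega
  rw [Set.one_lt_ncard_iff] at h2
  obtain ⟨a, b, ha, hb, hab⟩ := h2
  refine ⟨a, ?_, b, ?_, hab, p.toSubgraph.adj_sub ha, p.toSubgraph.adj_sub hb⟩
  · simpa using SimpleGraph.Walk.mem_support_of_adj_toSubgraph
      (SimpleGraph.Subgraph.Adj.symm ha)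
  · simpa using SimpleGraph.Walk.mem_support_of_adj_toSubgraph
      (SimpleGraph.Subgraph.Adj.symm hb)

theorem compat_pow (C : CartanADE J) (D : DiagAut C) (k : ℕ) (ι j : J) :
    C.a ((D.σ ^ k) ι) ((D.σ ^ k) j) = C.a ι j := by
  induction k with
  | zero => rfl
  | succ k ih => rw [pow_succ', Equiv.Perm.mul_apply, Equiv.Perm.mul_apply, D.compat, ih]

/-- fixed points of a power of `σ` are convex. -/
theorem fix_path (C : CartanADE J) (D : DiagAut C) (k : ℕ) {x y : J} (hx : (D.σ ^ k) x = x)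
    (hy : (D.σ ^ k) y = y) (p : (dG C).Walk x y) (hp : p.IsPath) (i : ℕ) :
    (D.σ ^ k) (p.getVert i) = p.getVert i := by
  let f : dG C →g dG C := ⟨⇑(D.σ ^ k), fun {a b} h => by
    rw [dG_adj] at h ⊢; rw [compat_pow]; exact h⟩
  have hq : ((p.map f).copy hx hy).IsPath := by
    simp only [SimpleGraph.Walk.isPath_copy]
    exact SimpleGraph.Walk.IsPath.map (D.σ ^ k).injective hp
  have := (dG_acyc C).subsingleton_path x y
  have h2 : (⟨p, hp⟩ : (dG C).Path x y) = ⟨_, hq⟩ := Subsingleton.elim _ _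
  have h3 : p = (p.map f).copy hx hy := congrArg Subtype.val h2
  conv_rhs => rw [h3]
  rw [SimpleGraph.Walk.getVert_copy, SimpleGraph.Walk.getVert_map]
  rfl

theorem exists_fix (C : CartanADE J) (D : DiagAut C) [Nonempty J] : ∃ v, D.σ v = v := by
  by_contra hno
  push Not at hno
  have hc : (dG C).Connected := ⟨dG_conn C⟩
  obtain ⟨v, hv⟩ := Finite.exists_min (fun v => (dG C).dist v (D.σ v))
  obtain ⟨p, hp⟩ := hc.exists_walk_length_eq_dist v (D.σ v)
  have hl0 : p.length ≠ 0 := by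
    rw [hp]; intro h; exact hno v ((hc.dist_eq_zero_iff).1 h).symm
  have hl1 : p.length ≠ 1 := by
    rw [hp]; intro h; rw [SimpleGraph.dist_eq_one_iff_adj] at h
    have := D.noAdj v 1 (by simpa using hno v)
    exact this (by simpa [dG_adj] using h)
  have hd : ∀ i j, i ≤ j → j ≤ p.length → (dG C).dist (p.getVert i) (p.getVert j) ≤ j - i := by
    intro i j hij hj
    induction j, hij using Nat.le_induction with
    | base => simp
    | succ j hij ih =>
      have h1 := hc.dist_triangle (u := p.getVert i) (v := p.getVert j) (w := p.getVert (j+1))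
      have h2 : (dG C).dist (p.getVert j) (p.getVert (j+1)) = 1 := by
        rw [SimpleGraph.dist_eq_one_iff_adj]; exact p.adj_getVert_succ (by omega)
      have := ih (by omega)
      omega
  have hne : D.σ (p.getVert 1) ≠ p.getVert (p.length - 1) := by
    intro h
    have h1 := hv (p.getVert 1)
    rw [h] at h1
    have h2 := hd 1 (p.length - 1) (by omega) (by omega)
    omega
  have adjp : ∀ (k i : ℕ), i < p.length →
      C.a ((D.σ ^ k) (p.getVert i)) ((D.σ ^ k) (p.getVert (i+1))) = -1 := by
    intro k i hi; rw [compat_pow]; exact p.adj_getVert_succ hi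
  have hend : p.getVert p.length = D.σ v := p.getVert_length
  have hst : p.getVert 0 = v := p.getVert_zero
  refine noCyc C (Finset.univ.filter fun x => ∃ k i : ℕ, 0 < i ∧ i ≤ p.length ∧
    x = (D.σ ^ k) (p.getVert i)) ⟨p.getVert 1, ?_⟩ ?_
  · simp only [Finset.mem_filter, Finset.mem_univ, true_and]
    exact ⟨0, 1, by omega, by omega, rfl⟩
  · intro x hx
    simp only [Finset.mem_filter, Finset.mem_univ, true_and] at hx ⊢
    obtain ⟨k, i, hi0, hil, rfl⟩ := hx
    have hr : 0 < orderOf D.σ := orderOf_pos D.σ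
    have hv' : v = (D.σ ^ (orderOf D.σ - 1)) (p.getVert p.length) := by
      rw [hend, ← Equiv.Perm.mul_apply, ← pow_succ, Nat.sub_add_cancel hr, pow_orderOf_eq_one]; rfl
    have memz : ∀ k i, i ≤ p.length → ∃ k' i' : ℕ, 0 < i' ∧ i' ≤ p.length ∧
        (D.σ ^ k) (p.getVert i) = (D.σ ^ k') (p.getVert i') := by
      intro k i hi
      rcases Nat.eq_zero_or_pos i with rfl | h0
      · refine ⟨k + (orderOf D.σ - 1), p.length, by omega, le_rfl, ?_⟩
        rw [hst, pow_add, Equiv.Perm.mul_apply, ← hv']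
      · exact ⟨k, i, h0, hi, rfl⟩
    rcases Nat.lt_or_ge i p.length with hlt | hge
    · refine ⟨(D.σ ^ k) (p.getVert (i-1)), memz _ _ (by omega), (D.σ ^ k) (p.getVert (i+1)),
        memz _ _ (by omega), ?_, ?_, adjp k i hlt⟩
      · intro h
        have h := (D.σ ^ k).injective h
        -- shortest paths do not backtrack
        have h1 := hd 0 (i-1) (by omega) (by omega)
        have h2 := hd (i+1) p.length (by omega) (by omega)
        have h3 := hc.dist_triangle (u := p.getVert 0) (v := p.getVert (i+1))
          (w := p.getVert p.length)
        rw [← h] at h3 h2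
        rw [hst, hend, ← hp] at h3
        rw [hend] at h2
        rw [hst] at h1
        omega
      · rw [C.symm]
        have := adjp k (i-1) (by omega)
        rwa [Nat.sub_add_cancel hi0] at this
    · obtain rfl : i = p.length := by omega
      refine ⟨(D.σ ^ k) (p.getVert (p.length-1)), memz _ _ (by omega),
        (D.σ ^ (k+1)) (p.getVert 1), memz _ _ (by omega), ?_, ?_, ?_⟩
      · rw [pow_succ, Equiv.Perm.mul_apply]
        intro h
        exact hne ((D.σ ^ k).injective h).symm
      · rw [C.symm]
        have := adjp k (p.length-1) (by omega)
        rwa [Nat.sub_add_cancel hi0] at this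
      · have := adjp (k+1) 0 (by omega)
        rw [hst] at this
        rw [hend]
        simpa [pow_succ] using this

theorem size_lt (C : CartanADE J) (D : DiagAut C) (ξ : J → ℤ) (hξ : IsHeightFunction C D ξ)
    (ι j : J) (h : C.a ι j = -1) (hs : orbitSize D.σ ι < orbitSize D.σ j) :
    orbitSize D.σ j = orderOf D.σ := by
  obtain ⟨j0, ⟨⟨k, hk⟩, -, h2⟩, -⟩ := hξ.2 ι j h hs
  have hle := Nat.le_of_dvd (orderOf_pos D.σ) (orbitSize_dvd D.σ j)
  by_contra hne
  have hlt : orbitSize D.σ j < orderOf D.σ := by omega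
  have h3 := h2 _ hlt
  have h4 : (D.σ ^ orbitSize D.σ j) j0 = j0 := by
    rw [pow_fix_iff, ← hk, orbitSize_pow]
  rw [h4] at h3
  have := orbitSize_pos D.σ j
  omega

theorem size_cases (C : CartanADE J) (D : DiagAut C) (ξ : J → ℤ) (hξ : IsHeightFunction C D ξ)
    (y : J) : orbitSize D.σ y = 1 ∨ orbitSize D.σ y = orderOf D.σ := by
  have : Nonempty J := ⟨y⟩
  obtain ⟨x, hx⟩ := exists_fix C D
  have hx1 : orbitSize D.σ x = 1 := by
    have : orbitSize D.σ x ∣ 1 := by rw [← pow_fix_iff]; simpa using hx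
    exact Nat.dvd_one.1 this
  by_contra hcon
  push Not at hcon
  have hle := Nat.le_of_dvd (orderOf_pos D.σ) (orbitSize_dvd D.σ y)
  have hlt : orbitSize D.σ y < orderOf D.σ := by omega
  obtain ⟨p, hp⟩ := (dG_conn C x y).exists_isPath
  have hf := fix_path C D (orbitSize D.σ y) (x := x) (y := y)
    (by rw [pow_fix_iff, hx1]; exact one_dvd _) (by rw [pow_fix_iff]) p hp
  have hsz : ∀ i, orbitSize D.σ (p.getVert i) < orderOf D.σ := fun i => by
    have := hf i
    rw [pow_fix_iff] at this
    have := Nat.le_of_dvd (orbitSize_pos D.σ y) this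
    omega
  have hall : ∀ i ≤ p.length, orbitSize D.σ (p.getVert i) = 1 := by
    intro i
    induction i with
    | zero => intro _; rw [p.getVert_zero]; exact hx1
    | succ i ih =>
      intro hi
      have h1 := ih (by omega)
      have hadj : C.a (p.getVert i) (p.getVert (i+1)) = -1 := p.adj_getVert_succ (by omega)
      by_contra hne
      have hpos := orbitSize_pos D.σ (p.getVert (i+1))
      have := size_lt C D ξ hξ _ _ hadj (by omega)
      have := hsz (i+1)
      omega
  have := hall p.length le_rfl
  rw [p.getVert_length] at this
  exact hcon.1 this

/-- The properties of a Q-datum used in the construction. -/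
structure Good (C : CartanADE J) (σ : Equiv.Perm J) (s : J → ℕ) (r : ℕ) (ξ : J → ℤ) : Prop where
  rpos : 1 ≤ r
  size : ∀ ι, s ι = 1 ∨ s ι = r
  exr : ∃ ι, s ι = r
  compat : ∀ ι j, C.a (σ ι) (σ j) = C.a ι j
  sσ : ∀ ι, s (σ ι) = s ι
  fix : ∀ ι, s ι = 1 → σ ι = ι
  pow : σ ^ r = 1
  eq : ∀ ι j, C.a ι j = -1 → s ι = s j → (2 * s ι : ℤ) ∣ ξ ι - ξ j - s ι
  par : ∀ ι j, C.a ι j = -1 → s ι = 1 → s j = r → r ≠ 1 → (2 : ℤ) ∣ ξ j - ξ ι - 1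
  shift : ∀ ι j, C.a ι j = -1 → s ι = 1 → s j = r → r ≠ 1 → (2 * r : ℤ) ∣ ξ (σ j) - ξ j + 2
  slice : ∀ ι j, C.a ι j = -1 → ξ ι < ξ j + 2 * s j

theorem good_of_height (C : CartanADE J) (D : DiagAut C) (ξ : J → ℤ)
    (hξ : IsHeightFunction C D ξ) [Nonempty J] :
    Good C D.σ (orbitSize D.σ) (orderOf D.σ) ξ := by
  have hsz := size_cases C D ξ hξ
  have hrpos : 1 ≤ orderOf D.σ := orderOf_pos D.σ
  have hfix : ∀ ι, orbitSize D.σ ι = 1 → D.σ ι = ι := by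
    intro ι h
    have := (pow_fix_iff D.σ ι 1).2 (by rw [h])
    simpa using this
  have hfixp : ∀ ι, orbitSize D.σ ι = 1 → ∀ k, (D.σ ^ k) ι = ι := by
    intro ι h k
    rw [pow_fix_iff, h]; exact one_dvd _
  have habs : ∀ x y : ℤ, |x| = y → x = y ∨ x = -y := by
    intro x y h; subst h; rcases abs_choice x with h | h <;> omega
  -- the main fact about mixed edges
  have mix : ∀ ι j, C.a ι j = -1 → orbitSize D.σ ι = 1 → orbitSize D.σ j = orderOf D.σ →
      orderOf D.σ ≠ 1 → ∃ j0 k, k < orderOf D.σ ∧ j = (D.σ ^ k) j0 ∧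
        (ξ ι = ξ j0 + 1 ∨ ξ ι = ξ j0 - 1) ∧
        (∀ k : ℕ, k < orderOf D.σ → ξ ((D.σ ^ k) j0) = ξ j0 - 2 * (k : ℤ)) := by
    intro ι j h h1 h2 hr
    obtain ⟨j0, ⟨⟨k, hk⟩, hab, h3⟩, -⟩ := hξ.2 ι j h (by omega)
    -- j = σ^(r - k % r) j0
    have hk' : (D.σ ^ (k % orderOf D.σ)) j = j0 := by rw [pow_mod_orderOf]; exact hk
    have hmod : k % orderOf D.σ < orderOf D.σ := Nat.mod_lt _ hrpos
    refine ⟨j0, (orderOf D.σ - k % orderOf D.σ) % orderOf D.σ, Nat.mod_lt _ hrpos, ?_, ?_, h3⟩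
    · rw [pow_mod_orderOf, ← hk', ← Equiv.Perm.mul_apply, ← pow_add,
        Nat.sub_add_cancel hmod.le, pow_orderOf_eq_one]; rfl
    · rcases habs _ _ hab with h | h
      · left; omega
      · right; omega
  refine ⟨hrpos, hsz, ?_, D.compat, ?_, hfix, pow_orderOf_eq_one _, ?_, ?_, ?_, ?_⟩
  · by_contra hno
    push Not at hno
    have : D.σ = 1 := by
      ext ι
      exact hfix ι ((hsz ι).resolve_right (hno ι))
    obtain ⟨ι⟩ := ‹Nonempty J›
    apply hno ι
    rw [(hsz ι).resolve_right (hno ι), this]; simp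
  · intro ι; simpa using orbitSize_pow D.σ ι 1
  · intro ι j h hs
    rcases habs _ _ (hξ.1 ι j h hs) with h | h
    · rw [h]; simp
    · rw [h]; exact ⟨-1, by ring⟩
  · intro ι j h h1 h2 hr
    obtain ⟨j0, k, hk, rfl, hh, h3⟩ := mix ι j h h1 h2 hr
    have := h3 k hk
    omega
  · intro ι j h h1 h2 hr
    obtain ⟨j0, k, hk, rfl, hh, h3⟩ := mix ι j h h1 h2 hr
    have e1 := h3 k hk
    rcases Nat.lt_or_ge (k+1) (orderOf D.σ) with hlt | hge
    · have e2 := h3 (k+1) hlt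
      rw [pow_succ', Equiv.Perm.mul_apply] at e2
      rw [e1, e2]; push_cast
      exact ⟨0, by ring⟩
    · have hk1 : k + 1 = orderOf D.σ := by omega
      have : D.σ ((D.σ ^ k) j0) = j0 := by
        rw [← Equiv.Perm.mul_apply, ← pow_succ', hk1, pow_orderOf_eq_one]; rfl
      rw [this, e1, ← hk1]; push_cast
      exact ⟨1, by ring⟩
  · intro ι j h
    have p1 := orbitSize_pos D.σ ι
    have p2 := orbitSize_pos D.σ j
    by_cases heq : orbitSize D.σ ι = orbitSize D.σ j
    · rcases habs _ _ (hξ.1 ι j h heq) with h | h <;> omega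
    · have h' : C.a j ι = -1 := by rw [C.symm]; exact h
      rcases hsz ι with a1 | a1 <;> rcases hsz j with a2 | a2
      · omega
      · obtain ⟨j0, k, hk, rfl, hh, h3⟩ := mix ι j h a1 a2 (by omega)
        have := h3 k hk
        omega
      · obtain ⟨j0, k, hk, rfl, hh, h3⟩ := mix j ι h' a2 a1 (by omega)
        have := h3 k hk
        omega
      · omega


/-! ### Quadratic forms -/

/-- The quadratic form of a real matrix. -/
def qf (M : J → J → ℝ) (x : J → ℝ) : ℝ := ∑ ι, ∑ j, x ι * M ι j * x j

theorem qf_null (M : J → J → ℝ) (hs : ∀ ι j, M ι j = M j ι) (hp : ∀ x, 0 ≤ qf M x) (x : J → ℝ)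
    (hx : qf M x = 0) (κ : J) : ∑ j, M κ j * x j = 0 := by
  have key : ∀ t : ℝ, qf M (fun i => x i + t * (if i = κ then 1 else 0)) =
      qf M x + 2 * t * (∑ j, M κ j * x j) + t ^ 2 * M κ κ := by
    intro t
    have e1 : ∑ ι, x ι * M ι κ = ∑ j, M κ j * x j :=
      Finset.sum_congr rfl fun j _ => by rw [hs j κ]; ring
    unfold qf
    simp only [add_mul, mul_add, Finset.sum_add_distrib]
    simp only [mul_ite, mul_one, mul_zero, ite_mul, zero_mul, Finset.sum_ite_eq',
      Finset.sum_ite_eq, Finset.mem_univ, if_true]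
    have e2 : ∑ ι, x ι * M ι κ * t = t * ∑ j, M κ j * x j := by
      rw [← e1, Finset.mul_sum]; exact Finset.sum_congr rfl fun j _ => by ring
    have e3 : ∑ j, t * M κ j * x j = t * ∑ j, M κ j * x j := by
      rw [Finset.mul_sum]; exact Finset.sum_congr rfl fun j _ => by ring
    have e4 : ∀ f : J → J → ℝ, (∑ ι, ∑ j, if ι = κ then f ι j else 0) = ∑ j, f κ j := by
      intro f; rw [Finset.sum_comm]; simp
    simp only [e4, Finset.sum_ite_eq', Finset.mem_univ, if_true, e2, e3]
    ring
  set B := ∑ j, M κ j * x j with hB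
  have hc : 0 ≤ M κ κ := by
    have := hp (fun i => if i = κ then 1 else 0)
    simpa [qf] using this
  by_contra hne
  have h1 := hp (fun i => x i + (-B / (M κ κ + 1)) * (if i = κ then 1 else 0))
  rw [key, hx] at h1
  have hc1 : 0 < M κ κ + 1 := by linarith
  have h2 : 0 + 2 * (-B / (M κ κ + 1)) * B + (-B / (M κ κ + 1)) ^ 2 * M κ κ =
      - (B ^ 2 * (M κ κ + 2)) / (M κ κ + 1) ^ 2 := by
    field_simp; ring
  rw [h2] at h1
  have h3 : 0 < B ^ 2 * (M κ κ + 2) / (M κ κ + 1) ^ 2 := by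
    have : 0 < B ^ 2 := by positivity
    positivity
  rw [neg_div] at h1
  linarith

theorem qf_continuous (M : J → J → ℝ) : Continuous (qf M) := by
  unfold qf; fun_prop

theorem cartan_real_nonneg (C : CartanADE J) (x : J → ℝ) : 0 ≤ qf (fun ι j => (C.a ι j : ℝ)) x := by
  have hd : DenseRange (Pi.map (fun _ : J => ((↑) : ℚ → ℝ))) :=
    DenseRange.piMap fun _ => Rat.denseRange_cast
  have hcl : IsClosed {x : J → ℝ | 0 ≤ qf (fun ι j => (C.a ι j : ℝ)) x} :=
    isClosed_le continuous_const (qf_continuous _)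
  refine hd.induction_on (p := fun x => 0 ≤ qf (fun ι j => (C.a ι j : ℝ)) x) x hcl ?_
  intro v
  by_cases hv : v = 0
  · subst hv; simp [qf, Pi.map]
  · have := C.posDef v hv
    have h2 : ((∑ ι : J, ∑ j : J, v ι * (C.a ι j : ℚ) * v j : ℚ) : ℝ) =
      qf (fun ι j => (C.a ι j : ℝ)) (Pi.map (fun _ : J => ((↑) : ℚ → ℝ)) v) := by
      unfold qf; push_cast; rfl
    rw [← h2]; exact_mod_cast this.le

theorem cartan_real_pos (C : CartanADE J) (x : J → ℝ) (hx : x ≠ 0) :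
    0 < qf (fun ι j => (C.a ι j : ℝ)) x := by
  refine lt_of_le_of_ne (cartan_real_nonneg C x) fun h0 => ?_
  have hn := qf_null (fun ι j => (C.a ι j : ℝ)) (fun ι j => by rw [C.symm])
    (cartan_real_nonneg C) x h0.symm
  let A : Matrix J J ℚ := Matrix.of fun ι j => (C.a ι j : ℚ)
  have h1 : (A.map (algebraMap ℚ ℝ)).det = 0 := by
    rw [← Matrix.exists_mulVec_eq_zero_iff]
    refine ⟨x, hx, ?_⟩
    funext κ
    simpa [Matrix.mulVec, dotProduct, A] using hn κ
  have h2 : A.det = 0 := by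
    have := RingHom.map_det (algebraMap ℚ ℝ) A
    rw [RingHom.mapMatrix_apply, h1] at this
    simpa using this
  rw [← Matrix.exists_mulVec_eq_zero_iff] at h2
  obtain ⟨v, hv, hv0⟩ := h2
  have := C.posDef v hv
  have h3 : (∑ ι : J, ∑ j : J, v ι * (C.a ι j : ℚ) * v j) = ∑ ι, v ι * (A.mulVec v) ι := by
    refine Finset.sum_congr rfl fun ι _ => ?_
    simp only [Matrix.mulVec, dotProduct, Finset.mul_sum, A, Matrix.of_apply]
    exact Finset.sum_congr rfl fun j _ => by ring
  rw [h3, hv0] at this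
  simp at this

/-! ### The eigenvector -/

/-- The Chebyshev-like sum. -/
noncomputable def Us (s : ℕ) (θ : ℝ) : ℝ := ∑ k ∈ Finset.range s, Real.cos (((s:ℝ) - 1 - 2 * k) * θ)

theorem Us_continuous (s : ℕ) : Continuous (Us s) := by unfold Us; fun_prop

theorem Us_pos (s : ℕ) (hs : 1 ≤ s) (θ : ℝ) (h0 : 0 ≤ θ) (h1 : s * θ ≤ Real.pi / 2) : 0 < Us s θ := by
  unfold Us
  have hpi := Real.pi_pos
  refine Finset.sum_pos (fun k hk => ?_) ⟨0, by simp; omega⟩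
  have hk : (k : ℝ) + 1 ≤ s := by exact_mod_cast Finset.mem_range.1 hk
  have hk0 : (0:ℝ) ≤ k := by positivity
  rcases h0.eq_or_lt with rfl | hθ
  · simp
  apply Real.cos_pos_of_mem_Ioo
  constructor <;> nlinarith

/-- The deformed Cartan matrix. -/
noncomputable def MM (C : CartanADE J) (s : J → ℕ) (r : ℕ) (θ : ℝ) (ι j : J) : ℝ :=
  if ι = j then (if s ι = 1 then r * Us r θ else 1) * (2 * Real.cos (s ι * θ))
  else if C.a ι j = -1 then
    -(if s ι = 1 then (if s j = 1 then r * Us r θ else Us r θ)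
      else (if s j = 1 then Us r θ else 1))
  else 0

theorem MM_symm (C : CartanADE J) (s : J → ℕ) (r : ℕ) (θ : ℝ) (ι j : J) :
    MM C s r θ ι j = MM C s r θ j ι := by
  unfold MM
  by_cases h : ι = j
  · subst h; rfl
  · rw [if_neg h, if_neg (Ne.symm h), C.symm j ι]
    split_ifs <;> rfl

theorem MM_continuous (C : CartanADE J) (s : J → ℕ) (r : ℕ) (ι j : J) :
    Continuous fun θ => MM C s r θ ι j := by
  have := Us_continuous r
  unfold MM
  split_ifs <;> fun_prop

theorem MM_off (C : CartanADE J) (s : J → ℕ) (r : ℕ) (θ : ℝ) (hU : 0 ≤ Us r θ) (ι j : J)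
    (h : ι ≠ j) : MM C s r θ ι j ≤ 0 := by
  unfold MM
  rw [if_neg h]
  split_ifs <;> simp <;> positivity

theorem eigen (C : CartanADE J) (σ : Equiv.Perm J) (s : J → ℕ) (r : ℕ) (ξ : J → ℤ)
    (hG : Good C σ s r ξ) :
    ∃ (θ : ℝ) (d : J → ℝ), 0 < θ ∧ r * θ ≤ Real.pi / 2 ∧ (∀ ι, 0 < d ι) ∧
      (∀ ι, d (σ ι) = d ι) ∧ ∀ ι, 2 * Real.cos (s ι * θ) * d ι =
        ∑ j, if C.a ι j = -1 then
          (if s ι = 1 then (if s j = 1 then 1 else 1 / (r:ℝ))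
            else (if s j = 1 then Us r θ else 1)) * d j else 0 := by
  have hpi := Real.pi_pos
  have hr0 : (0:ℝ) < r := by exact_mod_cast hG.rpos
  obtain ⟨κ, hκ⟩ := hG.exr
  set T : ℝ := Real.pi / (2 * r) with hT
  have hTr : r * T = Real.pi / 2 := by rw [hT]; field_simp
  have hT0 : 0 < T := by positivity
  let Q : ℝ × (J → ℝ) → ℝ := fun p => qf (MM C s r p.1) p.2
  have hQc : Continuous Q := by
    have hm := fun ι j => MM_continuous C s r ι j
    change Continuous fun p : ℝ × (J → ℝ) => ∑ ι, ∑ j, p.2 ι * MM C s r p.1 ι j * p.2 j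
    refine continuous_finsetSum _ fun ι _ => continuous_finsetSum _ fun j _ => ?_
    have := (hm ι j).comp (continuous_fst (X := ℝ) (Y := J → ℝ))
    simp only [Function.comp_def] at this
    fun_prop
  let K : Set (ℝ × (J → ℝ)) := (Set.Icc 0 T ×ˢ Metric.sphere 0 1) ∩ {p | Q p ≤ 0}
  have hK : IsCompact K :=
    (isCompact_Icc.prod (isCompact_sphere _ _)).inter_right (isClosed_le hQc continuous_const)
  have hKne : K.Nonempty := by
    refine ⟨(T, Pi.single κ 1), ⟨⟨⟨hT0.le, le_rfl⟩, ?_⟩, ?_⟩⟩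
    · rw [mem_sphere_zero_iff_norm]
      have := Pi.norm_single (G := fun _ : J => ℝ) (i := κ) (1:ℝ)
      simpa using this
    · change qf (MM C s r T) (Pi.single κ 1) ≤ 0
      have : qf (MM C s r T) (Pi.single κ 1) = MM C s r T κ κ := by
        simp [qf, Pi.single_apply]
      rw [this]
      unfold MM
      rw [if_pos rfl, hκ, hTr, Real.cos_pi_div_two]; simp
  obtain ⟨⟨θ, x⟩, hmem, hmin⟩ := hK.exists_isMinOn hKne continuous_fst.continuousOn
  obtain ⟨⟨⟨hθ0, hθT⟩, hxs⟩, hQ0⟩ := hmem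
  simp only at hθ0 hθT hxs
  have hx0 : x ≠ 0 := by
    rintro rfl; simp at hxs
  have hpos : ∀ t, 0 ≤ t → t < θ → ∀ y : J → ℝ, 0 ≤ qf (MM C s r t) y := by
    intro t ht htθ y
    by_contra hneg
    push Not at hneg
    have hy : y ≠ 0 := by rintro rfl; simp [qf] at hneg
    have hny : 0 < ‖y‖ := norm_pos_iff.2 hy
    have hm : (t, ‖y‖⁻¹ • y) ∈ K := by
      refine ⟨⟨⟨ht, by linarith⟩, ?_⟩, ?_⟩
      · simp [norm_smul, hny.ne']
      · change qf (MM C s r t) (‖y‖⁻¹ • y) ≤ 0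
        have : qf (MM C s r t) (‖y‖⁻¹ • y) = ‖y‖⁻¹ ^ 2 * qf (MM C s r t) y := by
          unfold qf; simp only [Finset.mul_sum, Pi.smul_apply, smul_eq_mul]
          exact Finset.sum_congr rfl fun _ _ => Finset.sum_congr rfl fun _ _ => by ring
        rw [this]
        have : 0 < ‖y‖⁻¹ ^ 2 := by positivity
        nlinarith
    have := hmin hm
    simp only [Set.mem_ofPred_eq] at this
    exact absurd htθ (not_lt.2 this)
  have hzero : ∀ y : J → ℝ, y ≠ 0 → 0 < qf (MM C s r 0) y := by
    intro y hy
    let t : J → ℝ := fun ι => if s ι = 1 then r else 1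
    have ht : ∀ ι, t ι ≠ 0 := by intro ι; simp only [t]; split_ifs <;> [exact hr0.ne'; norm_num]
    have hU : Us r 0 = r := by simp [Us]
    have : qf (MM C s r 0) y = qf (fun ι j => (C.a ι j : ℝ)) (fun ι => t ι * y ι) := by
      unfold qf
      refine Finset.sum_congr rfl fun ι _ => Finset.sum_congr rfl fun j _ => ?_
      have : MM C s r 0 ι j = t ι * C.a ι j * t j := by
        unfold MM
        by_cases h : ι = j
        · subst h; rw [if_pos rfl, C.diag, hU]; simp only [t]
          split_ifs <;> simp <;> ring
        · rw [if_neg h, hU]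
          simp only [t]
          rcases C.offDiag ι j h with h0 | h0
          · rw [h0]; simp
          · rw [h0]; simp only [if_true]; push_cast; split_ifs <;> ring
      rw [this]; ring
    rw [this]
    apply cartan_real_pos
    intro h0; apply hy; funext ι
    have := congrFun h0 ι
    simpa [ht ι] using this
  have hθpos : 0 < θ := by
    rcases hθ0.eq_or_lt with h | h
    · exfalso
      have h1 : qf (MM C s r θ) x ≤ 0 := hQ0
      rw [← h] at h1
      exact absurd (hzero x hx0) (not_lt.2 h1)
    · exact h
  have hpsd : ∀ y, 0 ≤ qf (MM C s r θ) y := by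
    intro y
    have hcl : IsClosed {t : ℝ | 0 ≤ qf (MM C s r t) y} := by
      refine isClosed_le continuous_const ?_
      have : Continuous fun t : ℝ => Q (t, y) := hQc.comp (by fun_prop)
      exact this
    have hsub : Set.Ico 0 θ ⊆ {t : ℝ | 0 ≤ qf (MM C s r t) y} :=
      fun t ht => hpos t ht.1 ht.2 y
    have := closure_minimal hsub hcl
    rw [closure_Ico hθpos.ne] at this
    exact this ⟨hθpos.le, le_rfl⟩
  have hrθ : r * θ ≤ Real.pi / 2 := by
    rw [← hTr]; exact mul_le_mul_of_nonneg_left hθT hr0.le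
  have hU : 0 < Us r θ := Us_pos r hG.rpos θ hθpos.le hrθ
  -- absolute value
  have habs : qf (MM C s r θ) (fun i => |x i|) = 0 := by
    refine le_antisymm (le_trans ?_ hQ0) (hpsd _)
    change _ ≤ qf (MM C s r θ) x
    unfold qf
    refine Finset.sum_le_sum fun ι _ => Finset.sum_le_sum fun j _ => ?_
    by_cases h : ι = j
    · subst h
      have : |x ι| * |x ι| = x ι * x ι := abs_mul_abs_self _
      have h5 : |x ι| * MM C s r θ ι ι * |x ι| = MM C s r θ ι ι * (|x ι| * |x ι|) := by ring
      simp only [h5, this]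
      exact le_of_eq (by ring)
    · have h1 := MM_off C s r θ hU.le ι j h
      have h2 : x ι * x j ≤ |x ι| * |x j| := by rw [← abs_mul]; exact le_abs_self _
      nlinarith
  have hnull := qf_null _ (MM_symm C s r θ) hpsd _ habs
  have hinv : ∀ ι j, MM C s r θ (σ ι) (σ j) = MM C s r θ ι j := by
    intro ι j; unfold MM; simp only [hG.compat, hG.sσ, σ.injective.eq_iff]
  have hinvk : ∀ (k : ℕ) ι j, MM C s r θ ((σ ^ k) ι) ((σ ^ k) j) = MM C s r θ ι j := by
    intro k
    induction k with
    | zero => intro ι j; rfl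
    | succ k ih =>
      intro ι j
      rw [pow_succ', Equiv.Perm.mul_apply, Equiv.Perm.mul_apply, hinv, ih]
  let d : J → ℝ := fun ι => ∑ k ∈ Finset.range r, |x ((σ ^ k) ι)|
  have hd0 : ∀ ι, 0 ≤ d ι := fun ι => Finset.sum_nonneg fun _ _ => abs_nonneg _
  have hdσ : ∀ ι, d (σ ι) = d ι := by
    intro ι
    have e : ∀ k, (σ ^ k) (σ ι) = (σ ^ (k+1)) ι := by intro k; rw [pow_succ]; rfl
    simp only [d, e]
    have h1 := Finset.sum_range_succ' (fun k => |x ((σ ^ k) ι)|) r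
    have h2 := Finset.sum_range_succ (fun k => |x ((σ ^ k) ι)|) r
    rw [hG.pow] at h2
    simp only [pow_zero] at h1 h2
    linarith
  have hdnull : ∀ ι, ∑ j, MM C s r θ ι j * d j = 0 := by
    intro ι
    simp only [d, Finset.mul_sum]
    rw [Finset.sum_comm]
    refine Finset.sum_eq_zero fun k _ => ?_
    rw [← hnull ((σ ^ k) ι), ← Equiv.sum_comp (σ ^ k) (fun j => MM C s r θ ((σ ^ k) ι) j * |x j|)]
    exact Finset.sum_congr rfl fun j _ => by rw [hinvk]
  have hdpos : ∀ ι, 0 < d ι := by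
    by_contra hcon
    push Not at hcon
    obtain ⟨ι0, hι0⟩ := hcon
    have hz := C.indec {ι | d ι = 0} ⟨ι0, le_antisymm hι0 (hd0 _)⟩ (by
      intro ι hι j hj
      have h1 := hdnull ι
      have hle : ∀ m ∈ Finset.univ, MM C s r θ ι m * d m ≤ 0 := by
        intro m _
        by_cases h : ι = m
        · subst h; rw [show d ι = 0 from hι]; simp
        · exact mul_nonpos_of_nonpos_of_nonneg (MM_off C s r θ hU.le ι m h) (hd0 m)
      have h2 := (Finset.sum_eq_zero_iff_of_nonpos hle).1 h1 j (Finset.mem_univ _)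
      have hne : MM C s r θ ι j ≠ 0 := by
        unfold MM
        rw [if_neg (ne_of_adj C hj), if_pos hj]
        split_ifs <;> simp <;> first | exact ⟨by omega, hU.ne'⟩ | exact hU.ne' | skip
        all_goals exact ⟨by have := hG.rpos; omega, hU.ne'⟩
      exact (mul_eq_zero.1 h2).resolve_left hne)
    apply hx0
    funext ι
    have h3 : d ι = 0 := by
      have : ι ∈ (Set.univ : Set J) := trivial
      rw [← hz] at this; exact this
    have h4 := (Finset.sum_eq_zero_iff_of_nonneg fun k _ => abs_nonneg _).1 h3 0
      (Finset.mem_range.2 hG.rpos)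
    simpa using h4
  refine ⟨θ, d, hθpos, hrθ, hdpos, hdσ, fun ι => ?_⟩
  clear_value d
  have h1 := hdnull ι
  rw [← Finset.add_sum_erase _ _ (Finset.mem_univ ι)] at h1
  set b : ℝ := (if s ι = 1 then r * Us r θ else 1) with hb
  have hbpos : 0 < b := by rw [hb]; split_ifs <;> positivity
  have h2 : MM C s r θ ι ι = b * (2 * Real.cos (s ι * θ)) := by
    unfold MM; rw [if_pos rfl]
  rw [h2] at h1
  apply mul_left_cancel₀ hbpos.ne'
  rw [Finset.mul_sum, ← Finset.add_sum_erase _ _ (Finset.mem_univ ι), if_neg (by rw [C.diag]; omega)]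
  have h3 : ∑ j ∈ Finset.univ.erase ι, MM C s r θ ι j * d j =
    - ∑ j ∈ Finset.univ.erase ι, b * (if C.a ι j = -1 then
          (if s ι = 1 then (if s j = 1 then 1 else 1 / (r:ℝ))
            else (if s j = 1 then Us r θ else 1)) * d j else 0) := by
    rw [← Finset.sum_neg_distrib]
    refine Finset.sum_congr rfl fun j hj => ?_
    have hj : ι ≠ j := by rintro rfl; simp at hj
    unfold MM
    rw [if_neg hj, hb]
    split_ifs <;> first | (field_simp; done) | ring
  linarith


/-! ### The mesh relation -/

/-- `Good` together with the eigenvector. -/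
structure Eig (C : CartanADE J) (σ : Equiv.Perm J) (s : J → ℕ) (r : ℕ) (ξ : J → ℤ) (θ : ℝ)
    (d : J → ℝ) : Prop extends Good C σ s r ξ where
  θpos : 0 < θ
  rθ : r * θ ≤ Real.pi / 2
  dpos : ∀ ι, 0 < d ι
  dσ : ∀ ι, d (σ ι) = d ι
  eig : ∀ ι, 2 * Real.cos (s ι * θ) * d ι =
        ∑ j, if C.a ι j = -1 then
          (if s ι = 1 then (if s j = 1 then 1 else 1 / (r:ℝ))
            else (if s j = 1 then Us r θ else 1)) * d j else 0

/-- Admissible heights of a vertex. -/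
def Ps (s : J → ℕ) (ξ : J → ℤ) (j : J) (q : ℤ) : Prop := (2 * s j : ℤ) ∣ q - ξ j

theorem Good.spos {C : CartanADE J} {σ : Equiv.Perm J} {s : J → ℕ} {r : ℕ} {ξ : J → ℤ}
    (h : Good C σ s r ξ) (ι : J) : 1 ≤ s ι := by
  have := h.rpos
  rcases h.size ι with h | h <;> omega

theorem shift_adj {C : CartanADE J} {σ : Equiv.Perm J} {s : J → ℕ} {r : ℕ} {ξ : J → ℤ}
    (h : Good C σ s r ξ) {ι : J} (hι : s ι = 1) (j : J) : C.a ι (σ j) = C.a ι j := by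
  conv_lhs => rw [← h.fix ι hι]
  exact h.compat ι j

theorem dvd_shift {m a b : ℤ} (h : m ∣ a - b) : m ∣ a ↔ m ∣ b := by
  constructor
  · intro h1; have := dvd_sub h1 h; simpa using this
  · intro h1; have := dvd_add h1 h; simpa using this

/-- Averaging over the `σ`-orbits. -/
theorem avg {C : CartanADE J} {σ : Equiv.Perm J} {s : J → ℕ} {r : ℕ} {ξ : J → ℤ} {θ : ℝ}
    {d : J → ℝ} (h : Eig C σ s r ξ θ d) (ι : J) (hι : s ι = 1) (a : ℤ) (ha : Ps s ξ ι a) :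
    r * (∑ j, if C.a ι j = -1 ∧ s j ≠ 1 ∧ Ps s ξ j (a + 1) then d j else 0) =
      ∑ j, if C.a ι j = -1 ∧ s j ≠ 1 then d j else 0 := by
  have hsr : ∀ j, s j ≠ 1 → s j = r := fun j hj => (h.size j).resolve_left hj
  let f : ℕ → ℝ := fun k =>
    ∑ j, if C.a ι j = -1 ∧ s j ≠ 1 ∧ Ps s ξ j (a + 1 + 2 * k) then d j else 0
  have hf : ∀ k, f k = f (k + 1) := by
    intro k
    simp only [f]
    rw [← Equiv.sum_comp σ]
    refine Finset.sum_congr rfl fun j _ => ?_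
    rw [shift_adj h.toGood hι, h.sσ, h.dσ]
    by_cases h1 : C.a ι j = -1 ∧ s j ≠ 1
    · have hs := hsr j h1.2
      have hsh := h.shift ι j h1.1 hι hs (by rw [← hs]; exact h1.2)
      have : Ps s ξ (σ j) (a + 1 + 2 * k) ↔ Ps s ξ j (a + 1 + 2 * ((k + 1 : ℕ) : ℤ)) := by
        unfold Ps
        rw [h.sσ, hs]
        apply dvd_shift
        have e : (a + 1 + 2 * (k:ℤ) - ξ (σ j)) - (a + 1 + 2 * ((k + 1 : ℕ) : ℤ) - ξ j) =
          - (ξ (σ j) - ξ j + 2) := by push_cast; ring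
        rw [e]; exact (dvd_neg).2 hsh
      simp only [this]
    · rw [if_neg (by tauto), if_neg (by tauto)]
  have hf0 : ∀ k, f k = f 0 := by
    intro k
    induction k with
    | zero => rfl
    | succ k ih => rw [← hf k, ih]
  have e0 : f 0 = ∑ j, if C.a ι j = -1 ∧ s j ≠ 1 ∧ Ps s ξ j (a + 1) then d j else 0 := by
    simp [f]
  rw [← e0]
  have e1 : ∑ k ∈ Finset.range r, f k = r * f 0 := by
    rw [Finset.sum_congr rfl fun k _ => hf0 k]; simp
  rw [← e1]
  simp only [f]
  rw [Finset.sum_comm]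
  refine Finset.sum_congr rfl fun j _ => ?_
  by_cases h1 : C.a ι j = -1 ∧ s j ≠ 1
  · have hs := hsr j h1.2
    have hpar := h.par ι j h1.1 hι hs (by rw [← hs]; exact h1.2)
    have hr : (0:ℤ) < r := by exact_mod_cast h.rpos
    unfold Ps at ha
    rw [hι] at ha
    obtain ⟨m, hm⟩ : (2:ℤ) ∣ a + 1 - ξ j := by
      have ha' : (2:ℤ) ∣ a - ξ ι := by simpa using ha
      omega
    -- unique k with r ∣ m + k
    have hk0 : 0 ≤ (-m) % r := Int.emod_nonneg _ hr.ne'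
    have hk1 : (-m) % r < r := Int.emod_lt_of_pos _ hr
    rw [if_pos h1]
    rw [Finset.sum_eq_single ((-m) % r).toNat]
    · rw [if_pos]
      refine ⟨h1.1, h1.2, ?_⟩
      unfold Ps
      rw [hs, Int.toNat_of_nonneg hk0]
      have e : a + 1 + 2 * ((-m) % r) - ξ j = 2 * (m + (-m) % r) := by linarith
      rw [e]
      apply mul_dvd_mul_left
      have := Int.mul_ediv_add_emod (-m) r
      exact ⟨-((-m) / r), by linarith⟩
    · intro k hk hne
      rw [if_neg]
      rintro ⟨-, -, hp⟩
      unfold Ps at hp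
      rw [hs, show a + 1 + 2 * (k:ℤ) - ξ j = 2 * (m + k) by linarith] at hp
      have hp2 : (r:ℤ) ∣ m + k := Int.dvd_of_mul_dvd_mul_left (by norm_num) hp
      apply hne
      have hkr : (k:ℤ) < r := by exact_mod_cast Finset.mem_range.1 hk
      have : (-m) % r = k := by
        rw [← Int.emod_eq_of_lt (by positivity) hkr]
        exact Int.ModEq.symm ((Int.modEq_iff_dvd).2 (by rw [show -m - (k:ℤ) = -(m+k) by ring]; exact dvd_neg.2 hp2))
      omega
    · intro hn
      exfalso; apply hn
      rw [Finset.mem_range]; omega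
  · rw [if_neg h1]
    refine Finset.sum_eq_zero fun k _ => if_neg (by tauto)


theorem mesh0 {C : CartanADE J} {σ : Equiv.Perm J} {s : J → ℕ} {r : ℕ} {ξ : J → ℤ} {θ : ℝ}
    {d : J → ℝ} (h : Eig C σ s r ξ θ d) (ι : J) :
    ∃ D1 D2 : ℝ, 0 ≤ D1 ∧ 0 ≤ D2 ∧ D2 + Us (s ι) θ * D1 = 2 * Real.cos (s ι * θ) * d ι ∧
      ∀ a : ℤ, Ps s ξ ι a → ∀ f : ℤ → ℝ,
        (∑ j, if C.a ι j = -1 then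
          d j * ∑ q ∈ (Finset.Ioo a (a + 2 * s ι)).filter (Ps s ξ j), f q else 0) =
        D2 * f (a + s ι) + D1 * ∑ k ∈ Finset.range (s ι), f (a + 1 + 2 * k) := by
  have hr0 : (r:ℝ) ≠ 0 := by have := h.rpos; positivity
  by_cases hι : s ι = 1
  · have e := h.eig ι
    refine ⟨0, 2 * Real.cos (s ι * θ) * d ι, le_rfl, ?_, by ring, ?_⟩
    · rw [e]
      refine Finset.sum_nonneg fun j _ => ?_
      have := (h.dpos j).le
      simp only [hι, if_true]
      split_ifs <;> positivity
    · intro a ha f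
      have hav := avg h ι hι a ha
      have hIoo : Finset.Ioo a (a + 2 * (s ι : ℤ)) = {a + 1} := by
        rw [hι]; ext q; simp; omega
      have hcast : a + (s ι : ℤ) = a + 1 := by rw [hι]; rfl
      rw [hIoo, hcast, zero_mul, add_zero, e]
      simp only [hι, if_true]
      have e2 : (∑ j, if C.a ι j = -1 then (if s j = 1 then 1 else 1 / (r:ℝ)) * d j else 0) =
          ∑ j, if C.a ι j = -1 ∧ Ps s ξ j (a + 1) then d j else 0 := by
        have e3 : (∑ j, if C.a ι j = -1 ∧ s j ≠ 1 ∧ Ps s ξ j (a + 1) then d j else 0) =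
          ∑ j, if C.a ι j = -1 ∧ s j ≠ 1 then 1 / (r:ℝ) * d j else 0 := by
          have : (∑ j, if C.a ι j = -1 ∧ s j ≠ 1 then 1 / (r:ℝ) * d j else 0) =
            1 / (r:ℝ) * ∑ j, if C.a ι j = -1 ∧ s j ≠ 1 then d j else 0 := by
            rw [Finset.mul_sum]
            exact Finset.sum_congr rfl fun j _ => by split_ifs <;> ring
          rw [this, ← hav]; field_simp
        have e4 : (∑ j, if C.a ι j = -1 ∧ Ps s ξ j (a + 1) then d j else 0) =
          (∑ j, if C.a ι j = -1 ∧ s j = 1 then d j else 0) +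
          ∑ j, if C.a ι j = -1 ∧ s j ≠ 1 ∧ Ps s ξ j (a + 1) then d j else 0 := by
          rw [← Finset.sum_add_distrib]
          refine Finset.sum_congr rfl fun j _ => ?_
          by_cases h1 : C.a ι j = -1
          · by_cases h2 : s j = 1
            · have : Ps s ξ j (a + 1) := by
                have hh := h.eq ι j h1 (by rw [hι, h2])
                unfold Ps at ha ⊢
                rw [hι] at ha hh
                rw [h2]
                push_cast at *
                omega
              simp [h1, h2, this]
            · simp [h1, h2]
          · simp [h1]
        rw [e4, e3, ← Finset.sum_add_distrib]
        refine Finset.sum_congr rfl fun j _ => ?_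
        by_cases h1 : C.a ι j = -1 <;> by_cases h2 : s j = 1 <;> simp [h1, h2]
      rw [e2, Finset.sum_mul]
      refine Finset.sum_congr rfl fun j _ => ?_
      by_cases h1 : C.a ι j = -1 <;> by_cases h2 : Ps s ξ j (a + 1) <;>
        simp [h1, h2, Finset.filter_singleton]
  · have hsr : s ι = r := (h.size ι).resolve_left hι
    have hr1 : r ≠ 1 := by rw [← hsr]; exact hι
    refine ⟨∑ j, if C.a ι j = -1 ∧ s j = 1 then d j else 0,
      ∑ j, if C.a ι j = -1 ∧ s j ≠ 1 then d j else 0, ?_, ?_, ?_, ?_⟩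
    · exact Finset.sum_nonneg fun j _ => by split_ifs <;> [exact (h.dpos j).le; rfl]
    · exact Finset.sum_nonneg fun j _ => by split_ifs <;> [exact (h.dpos j).le; rfl]
    · rw [h.eig, Finset.mul_sum, ← Finset.sum_add_distrib]
      refine Finset.sum_congr rfl fun j _ => ?_
      by_cases h1 : C.a ι j = -1 <;> by_cases h2 : s j = 1 <;> simp [h1, h2, hι]
      simp [hsr]
    · intro a ha f
      rw [Finset.sum_mul, Finset.sum_mul, ← Finset.sum_add_distrib]
      refine Finset.sum_congr rfl fun j _ => ?_
      by_cases h1 : C.a ι j = -1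
      swap
      · simp [h1]
      by_cases h2 : s j = 1
      · have hpar := h.par j ι (by rw [C.symm]; exact h1) h2 hsr hr1
        have : (Finset.Ioo a (a + 2 * (s ι : ℤ))).filter (Ps s ξ j) =
            (Finset.range (s ι)).image fun k : ℕ => a + 1 + 2 * (k:ℤ) := by
          ext q
          simp only [Finset.mem_filter, Finset.mem_Ioo, Finset.mem_image, Finset.mem_range, Ps, h2]
          have ha2 : (2:ℤ) ∣ a - ξ ι := dvd_trans (by simp) ha
          constructor
          · rintro ⟨⟨q1, q2⟩, q3⟩
            have q3' : (2:ℤ) ∣ q - ξ j := by simpa using q3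
            refine ⟨((q - a - 1) / 2).toNat, ?_, ?_⟩ <;> omega
          · rintro ⟨k, hk, rfl⟩
            push_cast
            refine ⟨⟨by omega, by omega⟩, ?_⟩
            omega
        rw [this, Finset.sum_image (by intro x _ y _ hxy; simpa using hxy)]
        simp [h1, h2]
      · have hj : s j = r := (h.size j).resolve_left h2
        have hh := h.eq ι j h1 (by rw [hsr, hj])
        have : (Finset.Ioo a (a + 2 * (s ι : ℤ))).filter (Ps s ξ j) = {a + (s ι:ℤ)} := by
          ext q
          simp only [Finset.mem_filter, Finset.mem_Ioo, Finset.mem_singleton, Ps, hj, hsr]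
          unfold Ps at ha
          rw [hsr] at ha hh
          have hrp : (1:ℤ) ≤ r := by exact_mod_cast h.rpos
          -- the residue of the admissible heights
          have hres : (2 * r : ℤ) ∣ q - ξ j ↔ (2 * r : ℤ) ∣ q - (a + r) := by
            apply dvd_shift
            have := dvd_add ha hh
            have h3 := dvd_add this (dvd_refl (2 * r : ℤ))
            have e : q - ξ j - (q - (a + r)) = a - ξ ι + (ξ ι - ξ j - r) + 2 * r := by ring
            rw [e]; exact h3
          rw [hres]
          constructor
          · rintro ⟨⟨q1, q2⟩, q3⟩
            have := Int.eq_zero_of_abs_lt_dvd q3 (by rw [abs_lt]; constructor <;> linarith)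
            linarith
          · rintro rfl
            refine ⟨⟨by linarith, by linarith⟩, by simp⟩
        rw [this]
        simp [h1, h2]

/-- Sine waves. -/
noncomputable def gS (θ τ : ℝ) (q : ℤ) : ℝ := Real.sin (θ * (q - τ))

theorem Us_sum (s : ℕ) (θ : ℝ) (τ : ℝ) (a : ℤ) :
    ∑ k ∈ Finset.range s, gS θ τ (a + 1 + 2 * k) = Us s θ * gS θ τ (a + s) := by
  have hrefl := Finset.sum_range_reflect (fun k : ℕ => gS θ τ (a + 1 + 2 * (k:ℤ))) s
  have h2 : 2 * ∑ k ∈ Finset.range s, gS θ τ (a + 1 + 2 * k) = 2 * (Us s θ * gS θ τ (a + s)) := by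
    rw [two_mul]
    nth_rw 1 [← hrefl]
    rw [← Finset.sum_add_distrib]
    unfold Us
    rw [Finset.sum_mul, Finset.mul_sum]
    refine Finset.sum_congr rfl fun k hk => ?_
    have hk : k + 1 ≤ s := Finset.mem_range.1 hk
    have hc : ((s - 1 - k : ℕ) : ℝ) = s - 1 - k := by
      rw [Nat.sub_sub, Nat.cast_sub (by omega)]; push_cast; ring
    simp only [gS]
    push_cast
    rw [hc]
    have e1 : θ * ((a:ℝ) + 1 + 2 * (s - 1 - k) - τ) = θ * (a + s - τ) + (s - 1 - 2 * k) * θ := by ring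
    have e2 : θ * ((a:ℝ) + 1 + 2 * k - τ) = θ * (a + s - τ) - (s - 1 - 2 * k) * θ := by ring
    rw [e1, e2, Real.sin_add, Real.sin_sub]
    ring
  linarith

theorem mesh {C : CartanADE J} {σ : Equiv.Perm J} {s : J → ℕ} {r : ℕ} {ξ : J → ℤ} {θ : ℝ}
    {d : J → ℝ} (h : Eig C σ s r ξ θ d) (ι : J) (a : ℤ) (ha : Ps s ξ ι a) (τ : ℝ) :
    (∑ j, if C.a ι j = -1 then
          d j * ∑ q ∈ (Finset.Ioo a (a + 2 * s ι)).filter (Ps s ξ j), gS θ τ q else 0) =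
      d ι * (gS θ τ a + gS θ τ (a + 2 * s ι)) := by
  obtain ⟨D1, D2, -, -, hD, hm⟩ := mesh0 h ι
  rw [hm a ha, Us_sum]
  have e : D2 * gS θ τ (a + s ι) + D1 * (Us (s ι) θ * gS θ τ (a + s ι)) =
    (D2 + Us (s ι) θ * D1) * gS θ τ (a + s ι) := by ring
  rw [e, hD]
  have : gS θ τ a + gS θ τ (a + 2 * s ι) = 2 * Real.cos (s ι * θ) * gS θ τ (a + s ι) := by
    simp only [gS]
    push_cast
    have e1 : θ * ((a:ℝ) - τ) = θ * (a + s ι - τ) - s ι * θ := by ring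
    have e2 : θ * ((a:ℝ) + 2 * s ι - τ) = θ * (a + s ι - τ) + s ι * θ := by ring
    rw [e1, e2, Real.sin_add, Real.sin_sub]; ring
  rw [this]; ring

/-! ### The functional -/

/-- Slices of the repetition quiver. -/
def IsSl (C : CartanADE J) (s : J → ℕ) (ξ η : J → ℤ) : Prop :=
  (∀ ι, Ps s ξ ι (η ι)) ∧ ∀ ι j, C.a ι j = -1 → η ι < η j + 2 * s j

theorem IsSl_fire {C : CartanADE J} {s : J → ℕ} {ξ η : J → ℤ} (h : IsSl C s ξ η) {k : J}
    (hk : IsSource C η k) : IsSl C s ξ (fire s η k) := by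
  refine ⟨fun ι => ?_, fun ι j hij => ?_⟩
  · by_cases e : ι = k
    · subst e; rw [fire_self]; unfold Ps
      have := dvd_sub (h.1 ι) (dvd_refl (2 * s ι : ℤ))
      rwa [sub_right_comm] at this
    · rw [fire_ne s η e]; exact h.1 ι
  · by_cases e : j = k
    · subst e
      rw [fire_self, fire_ne s η (ne_of_adj C hij)]
      have := hk ι (by rw [C.symm]; exact hij)
      linarith
    · rw [fire_ne s η e]
      have := fire_le s η k ι
      have := h.2 ι j hij
      linarith

/-- Sum over the admissible heights in an interval. -/
noncomputable def W (s : J → ℕ) (ξ : J → ℤ) (g : ℤ → ℝ) (j : J) (a b : ℤ) : ℝ :=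
  ∑ q ∈ (Finset.Ioc a b).filter (Ps s ξ j), g q

noncomputable def zf (C : CartanADE J) (s : J → ℕ) (ξ : J → ℤ) (d : J → ℝ) (g : ℤ → ℝ)
    (η : J → ℤ) (ι : J) : ℝ :=
  d ι * g (η ι) - ∑ j, if C.a ι j = -1 then d j * W s ξ g j (η ι) (η j) else 0

noncomputable def Zf (C : CartanADE J) (s : J → ℕ) (ξ : J → ℤ) (d : J → ℝ) (g : ℤ → ℝ)
    (η : J → ℤ) (v : J → ℤ) : ℝ := ∑ ι, (v ι : ℝ) * zf C s ξ d g η ι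

theorem W_empty (s : J → ℕ) (ξ : J → ℤ) (g : ℤ → ℝ) (j : J) (a b : ℤ) (h : b ≤ a) :
    W s ξ g j a b = 0 := by
  unfold W; rw [Finset.Ioc_eq_empty (by omega)]; simp

theorem Ps_gap {s : J → ℕ} {ξ : J → ℤ} {j : J} {p q : ℤ} (hp : Ps s ξ j p) (hq : Ps s ξ j q)
    (h1 : p < q) : p + 2 * s j ≤ q := by
  unfold Ps at hp hq
  have h2 : (2 * s j : ℤ) ∣ q - p := by
    have := dvd_sub hq hp; simpa using this
  have := Int.le_of_dvd (by omega) h2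
  omega

theorem W_split {s : J → ℕ} (ξ : J → ℤ) (g : ℤ → ℝ) {j : J} (hs : 1 ≤ s j) {a b : ℤ}
    (hb : Ps s ξ j b) (hab : a < b) :
    W s ξ g j a b = g b + W s ξ g j a (b - 2 * s j) := by
  unfold W
  have : (Finset.Ioc a b).filter (Ps s ξ j) =
      insert b ((Finset.Ioc a (b - 2 * s j)).filter (Ps s ξ j)) := by
    ext q
    simp only [Finset.mem_filter, Finset.mem_Ioc, Finset.mem_insert]
    constructor
    · rintro ⟨⟨h1, h2⟩, h3⟩
      rcases eq_or_lt_of_le h2 with h4 | h4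
      · left; exact h4
      · right
        have := Ps_gap h3 hb h4
        exact ⟨⟨h1, by omega⟩, h3⟩
    · rintro (rfl | ⟨⟨h1, h2⟩, h3⟩)
      · exact ⟨⟨hab, le_rfl⟩, hb⟩
      · exact ⟨⟨h1, by omega⟩, h3⟩
  rw [this, Finset.sum_insert]
  simp only [Finset.mem_filter, Finset.mem_Ioc]
  omega

section
variable {C : CartanADE J} {σ : Equiv.Perm J} {s : J → ℕ} {r : ℕ} {ξ : J → ℤ} {θ : ℝ}
    {d : J → ℝ}

theorem zf_source (g : ℤ → ℝ) {η : J → ℤ} {k : J}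
    (hk : IsSource C η k) : zf C s ξ d g η k = d k * g (η k) := by
  unfold zf
  rw [Finset.sum_eq_zero, sub_zero]
  intro j _
  split_ifs with hj
  · rw [W_empty _ _ _ _ _ _ (hk j hj).le, mul_zero]
  · rfl

theorem zf_fire_self (h : Eig C σ s r ξ θ d) {η : J → ℤ} (hη : IsSl C s ξ η) {k : J}
    (hk : IsSource C η k) (τ : ℝ) :
    zf C s ξ d (gS θ τ) (fire s η k) k = - (d k * gS θ τ (η k)) := by
  have hsp := h.spos k
  have ha : Ps s ξ k (η k - 2 * s k) := by
    have := (IsSl_fire hη hk).1 k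
    rwa [fire_self] at this
  have hm := mesh h k _ ha τ
  rw [sub_add_cancel] at hm
  unfold zf
  rw [fire_self]
  have e : (∑ j, if C.a k j = -1 then d j * W s ξ (gS θ τ) j (η k - 2 * s k) (fire s η k j) else 0) =
    (∑ j, if C.a k j = -1 then
          d j * ∑ q ∈ (Finset.Ioo (η k - 2 * s k) (η k)).filter (Ps s ξ j), gS θ τ q else 0) := by
    refine Finset.sum_congr rfl fun j _ => ?_
    split_ifs with hj
    · congr 1
      rw [fire_ne s η (ne_of_adj C hj).symm]
      unfold W
      congr 1
      ext q
      simp only [Finset.mem_filter, Finset.mem_Ioc, Finset.mem_Ioo]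
      have h1 := hk j hj
      have h2 := hη.2 k j hj
      constructor
      · rintro ⟨⟨q1, q2⟩, q3⟩
        exact ⟨⟨q1, by omega⟩, q3⟩
      · rintro ⟨⟨q1, q2⟩, q3⟩
        refine ⟨⟨q1, ?_⟩, q3⟩
        by_contra hc
        have := Ps_gap (hη.1 j) q3 (by omega)
        omega
    · rfl
  rw [e, hm]; ring

theorem zf_fire (h : Eig C σ s r ξ θ d) {η : J → ℤ} (hη : IsSl C s ξ η) {k : J}
    (hk : IsSource C η k) (τ : ℝ) (ι : J) :
    zf C s ξ d (gS θ τ) (fire s η k) ι - C.a ι k * zf C s ξ d (gS θ τ) (fire s η k) k =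
      zf C s ξ d (gS θ τ) η ι := by
  rw [zf_fire_self h hη hk]
  by_cases e : ι = k
  · subst e; rw [zf_fire_self h hη hk, zf_source _ hk, C.diag]; push_cast; ring
  · unfold zf
    rw [fire_ne s η e]
    rcases C.offDiag ι k e with h0 | h0
    · rw [h0]
      have : (∑ j, if C.a ι j = -1 then d j * W s ξ (gS θ τ) j (η ι) (fire s η k j) else 0) =
        ∑ j, if C.a ι j = -1 then d j * W s ξ (gS θ τ) j (η ι) (η j) else 0 := by
        refine Finset.sum_congr rfl fun j _ => ?_
        split_ifs with hj
        · rw [fire_ne s η (by rintro rfl; omega)]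
        · rfl
      rw [this]; push_cast; ring
    · have hadj : C.a k ι = -1 := by rw [C.symm]; exact h0
      rw [h0]
      rw [← Finset.add_sum_erase _ _ (Finset.mem_univ k),
        ← Finset.add_sum_erase (a := k) _ (fun j => if C.a ι j = -1 then
          d j * W s ξ (gS θ τ) j (η ι) (η j) else 0) (Finset.mem_univ k)]
      have : (∑ j ∈ Finset.univ.erase k,
          if C.a ι j = -1 then d j * W s ξ (gS θ τ) j (η ι) (fire s η k j) else 0) =
        ∑ j ∈ Finset.univ.erase k,
          if C.a ι j = -1 then d j * W s ξ (gS θ τ) j (η ι) (η j) else 0 := by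
        refine Finset.sum_congr rfl fun j hj => ?_
        rw [fire_ne s η (Finset.ne_of_mem_erase hj)]
      rw [this]
      simp only [h0, if_true]
      rw [fire_self, W_split ξ _ (h.spos k) (hη.1 k) (hk ι hadj)]
      push_cast; ring

theorem Zf_simple (g : ℤ → ℝ) (η : J → ℤ) (k : J) :
    Zf C s ξ d g η (simpleRoot k) = zf C s ξ d g η k := by
  simp [Zf, simpleRoot]

theorem Zf_fire (h : Eig C σ s r ξ θ d) {η : J → ℤ} (hη : IsSl C s ξ η) {k : J}
    (hk : IsSource C η k) (τ : ℝ) (v : J → ℤ) :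
    Zf C s ξ d (gS θ τ) (fire s η k) v = Zf C s ξ d (gS θ τ) η (reflS C k v) := by
  have h1 : Zf C s ξ d (gS θ τ) η (reflS C k v) =
    Zf C s ξ d (gS θ τ) η v - (∑ κ, (v κ : ℝ) * C.a κ k) * zf C s ξ d (gS θ τ) η k := by
    rw [← Zf_simple]
    unfold Zf reflS
    rw [Finset.mul_sum, ← Finset.sum_sub_distrib]
    refine Finset.sum_congr rfl fun j _ => ?_
    push_cast; ring
  rw [h1, zf_source _ hk]
  have h2 : Zf C s ξ d (gS θ τ) η v = Zf C s ξ d (gS θ τ) (fire s η k) v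
      + (∑ κ, (v κ : ℝ) * C.a κ k) * (d k * gS θ τ (η k)) := by
    unfold Zf
    rw [Finset.sum_mul, ← Finset.sum_add_distrib]
    refine Finset.sum_congr rfl fun j _ => ?_
    rw [← zf_fire h hη hk, zf_fire_self h hη hk]; ring
  rw [h2]; ring

theorem Zf_act (h : Eig C σ s r ξ θ d) (τ : ℝ) (v : J → ℤ) (u : List J) (η : J → ℤ)
    (hη : IsSl C s ξ η) (hu : AdL C s η u) :
    Zf C s ξ d (gS θ τ) η (act C u v) = Zf C s ξ d (gS θ τ) (hA s η u) v := by
  induction u generalizing η with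
  | nil => rfl
  | cons k u ih =>
    rw [act_cons, ← Zf_fire h hη hu.1, ih _ (IsSl_fire hη hu.1) hu.2]; rfl

theorem IsSl_hA (u : List J) (η : J → ℤ)
    (hη : IsSl C s ξ η) (hu : AdL C s η u) : IsSl C s ξ (hA s η u) := by
  induction u generalizing η with
  | nil => exact hη
  | cons k u ih => exact ih _ (IsSl_fire hη hu.1) hu.2

theorem hA_le (u : List J) (η : J → ℤ) (κ : J) : hA s η u κ ≤ η κ := by
  induction u generalizing η with
  | nil => rfl
  | cons k u ih => exact (ih (fire s η k)).trans (fire_le s η k κ)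

theorem Zf_betas (h : Eig C σ s r ξ θ d) (τ : ℝ) (u : List J) (η : J → ℤ)
    (hη : IsSl C s ξ η) (hu : AdL C s η u) : ∀ β ∈ betas C u, ∃ (κ : J) (p : ℤ),
      Zf C s ξ d (gS θ τ) η β = d κ * gS θ τ p ∧ hA s η u κ + 2 * s κ ≤ p ∧ p ≤ η κ := by
  induction u generalizing η with
  | nil => simp [betas]
  | cons k u ih =>
    intro β hβ
    simp only [betas, List.mem_cons, List.mem_map] at hβ
    rcases hβ with rfl | ⟨β', hβ', rfl⟩
    · refine ⟨k, η k, ?_, ?_, le_rfl⟩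
      · rw [Zf_simple, zf_source _ hu.1]
      · have : hA s η (k :: u) k ≤ fire s η k k := hA_le u _ k
        rw [fire_self] at this; omega
    · obtain ⟨κ, p, h1, h2, h3⟩ := ih _ (IsSl_fire hη hu.1) hu.2 β' hβ'
      refine ⟨κ, p, ?_, h2, h3.trans (fire_le s η k κ)⟩
      rw [← Zf_fire h hη hu.1, h1]

end


theorem Us_sin (s : ℕ) (θ : ℝ) : Real.sin θ * Us s θ = Real.sin (s * θ) := by
  have h : 2 * (Real.sin θ * Us s θ) = Real.sin (s * θ) - Real.sin (((s:ℝ) - 2 * s) * θ) := by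
    have := Finset.sum_range_sub' (fun k : ℕ => Real.sin (((s:ℝ) - 2 * k) * θ)) s
    simp only [Nat.cast_zero, mul_zero, sub_zero] at this
    rw [← this, Us, Finset.mul_sum, Finset.mul_sum]
    refine Finset.sum_congr rfl fun k _ => ?_
    have e1 : ((s:ℝ) - 2 * k) * θ = (s - 1 - 2 * k) * θ + θ := by ring
    have e2 : ((s:ℝ) - 2 * (k + 1 : ℕ)) * θ = (s - 1 - 2 * k) * θ - θ := by push_cast; ring
    rw [e1, e2, Real.sin_add, Real.sin_sub]; ring
  have e : ((s:ℝ) - 2 * s) * θ = -(s * θ) := by ring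
  rw [e, Real.sin_neg] at h
  linarith

theorem anal2 (s : ℕ) (θ x : ℝ) (hθ : 0 < θ) (hs : s * θ ≤ Real.pi / 2) (h0 : 0 < x)
    (h1 : x < 2 * s) : 2 * Real.cos (s * θ) * Real.sin (θ * (x - s)) < Real.sin (θ * x) := by
  have hp := Real.pi_pos
  have : 0 < Real.sin (θ * (2 * s - x)) := by
    apply Real.sin_pos_of_pos_of_lt_pi
    · apply mul_pos hθ; linarith
    · nlinarith
  have e1 : θ * x = θ * (x - s) + s * θ := by ring
  have e2 : θ * (2 * s - x) = s * θ - θ * (x - s) := by ring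
  rw [e2, Real.sin_sub] at this
  rw [e1, Real.sin_add]
  linarith

theorem anal1 (s : ℕ) (hs1 : 1 ≤ s) (θ x : ℝ) (hθ : 0 < θ) (hs : s * θ ≤ Real.pi / 2) (h0 : 0 < x)
    (h1 : x < 2 * s) (f : ℕ → ℝ) (t : ℝ) (hf : ∀ k : ℕ, f k =
      if (1 + 2 * k : ℝ) < t then Real.sin (θ * (x - 1 - 2 * k)) else 0) :
    2 * Real.cos (s * θ) * ∑ k ∈ Finset.range s, f k < Us s θ * Real.sin (θ * x) := by
  have hp := Real.pi_pos
  have hs1' : (1:ℝ) ≤ s := by exact_mod_cast hs1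
  have key : ∀ n : ℕ, ∃ m : ℕ, 2 * Real.sin θ * ∑ k ∈ Finset.range n, f k =
      Real.cos (θ * (x - 2 * m)) - Real.cos (θ * x) ∧ (m = n ∨ t ≤ 1 + 2 * n) := by
    intro n
    induction n with
    | zero => exact ⟨0, by simp, Or.inl rfl⟩
    | succ n ih =>
      obtain ⟨m, e, hm⟩ := ih
      rw [Finset.sum_range_succ, mul_add, e, hf]
      by_cases ht : (1 + 2 * n : ℝ) < t
      · have hmn : m = n := hm.resolve_right (by linarith)
        subst hmn
        refine ⟨m + 1, ?_, Or.inl rfl⟩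
        rw [if_pos ht]
        have e1 : θ * (x - 2 * m) = θ * (x - 1 - 2 * m) + θ := by ring
        have e2 : θ * (x - 2 * (m + 1 : ℕ)) = θ * (x - 1 - 2 * m) - θ := by push_cast; ring
        rw [e1, e2, Real.cos_add, Real.cos_sub]; ring
      · refine ⟨m, by rw [if_neg ht]; ring, Or.inr ?_⟩
        push_cast; linarith
  obtain ⟨m, e, -⟩ := key s
  have hle := Real.cos_le_one (θ * (x - 2 * m))
  have hsin : 0 < Real.sin θ := Real.sin_pos_of_pos_of_lt_pi hθ (by nlinarith)
  have hc : 0 ≤ Real.cos (s * θ) := Real.cos_nonneg_of_neg_pi_div_two_le_of_le (by nlinarith) hs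
  have h3 : Real.cos (s * θ) < Real.cos (θ * (x - s)) := by
    rw [← Real.cos_abs (θ * (x - s))]
    apply Real.cos_lt_cos_of_nonneg_of_le_pi (abs_nonneg _) (by linarith)
    rw [abs_mul, abs_of_pos hθ, mul_comm]
    apply mul_lt_mul_of_pos_right _ hθ
    rw [abs_lt]; constructor <;> linarith
  have e3 : Real.cos (θ * (x - s)) = Real.cos (θ * x) * Real.cos (s * θ) +
      Real.sin (θ * x) * Real.sin (s * θ) := by
    rw [← Real.cos_sub]; congr 1; ring
  rw [← Us_sin] at e3
  have h4 : Real.sin θ * (2 * Real.cos (s * θ) * ∑ k ∈ Finset.range s, f k) <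
      Real.sin θ * (Us s θ * Real.sin (θ * x)) := by
    have : Real.sin θ * (2 * Real.cos (s * θ) * ∑ k ∈ Finset.range s, f k) =
      Real.cos (s * θ) * (2 * Real.sin θ * ∑ k ∈ Finset.range s, f k) := by ring
    rw [this, e]
    have h5 := mul_le_mul_of_nonneg_left hle hc
    linarith
  exact lt_of_mul_lt_mul_left h4 hsin.le

/-- Slices cut at level `t`. -/
def Xi (s : J → ℕ) (ξ : J → ℤ) (t : ℤ) (ι : J) : ℤ := t - (t - ξ ι) % (2 * s ι)

theorem Xi_Ps (s : J → ℕ) (ξ : J → ℤ) (t : ℤ) (ι : J) : Ps s ξ ι (Xi s ξ t ι) := by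
  unfold Ps Xi
  have := Int.dvd_sub_self_of_emod_eq (a := t - ξ ι) (b := 2 * (s ι : ℤ)) rfl
  have h2 := Int.mul_ediv_add_emod (t - ξ ι) (2 * s ι)
  exact ⟨(t - ξ ι) / (2 * s ι), by linarith⟩

theorem Xi_le (s : J → ℕ) (ξ : J → ℤ) (hs : ∀ ι, 1 ≤ s ι) (t : ℤ) (ι : J) : Xi s ξ t ι ≤ t := by
  unfold Xi
  have := Int.emod_nonneg (t - ξ ι) (b := 2 * (s ι : ℤ)) (by have := hs ι; omega)
  linarith

theorem Xi_gt (s : J → ℕ) (ξ : J → ℤ) (hs : ∀ ι, 1 ≤ s ι) (t : ℤ) (ι : J) :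
    t < Xi s ξ t ι + 2 * s ι := by
  unfold Xi
  have := Int.emod_lt_of_pos (t - ξ ι) (b := 2 * (s ι : ℤ)) (by have := hs ι; omega)
  linarith

theorem Xi_uniq (s : J → ℕ) (ξ : J → ℤ) (hs : ∀ ι, 1 ≤ s ι) (t : ℤ) (ι : J) (q : ℤ)
    (h : Ps s ξ ι q) (h1 : q ≤ t) (h2 : t < q + 2 * s ι) : Xi s ξ t ι = q := by
  have a1 := Xi_le s ξ hs t ι
  have a2 := Xi_gt s ξ hs t ι
  have a3 := Xi_Ps s ξ t ι
  unfold Ps at h a3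
  have := dvd_sub a3 h
  have := Int.eq_zero_of_abs_lt_dvd this (by rw [abs_lt]; constructor <;> linarith)
  linarith

theorem Xi_IsSl (C : CartanADE J) (s : J → ℕ) (ξ : J → ℤ) (hs : ∀ ι, 1 ≤ s ι) (t : ℤ) :
    IsSl C s ξ (Xi s ξ t) :=
  ⟨Xi_Ps s ξ t, fun ι j _ => lt_of_le_of_lt (Xi_le s ξ hs t ι) (Xi_gt s ξ hs t j)⟩

theorem Xi_neg {C : CartanADE J} {σ : Equiv.Perm J} {s : J → ℕ} {r : ℕ} {ξ : J → ℤ} {θ : ℝ}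
    {d : J → ℝ} (h : Eig C σ s r ξ θ d) (t : ℤ) (τ : ℝ) (h0 : (t:ℝ) < τ) (h1 : τ < t + 1) (ι : J) :
    zf C s ξ d (gS θ τ) (Xi s ξ t) ι < 0 := by
  have hs : ∀ ι, 1 ≤ s ι := fun ι => h.spos ι
  have hp := Real.pi_pos
  obtain ⟨D1, D2, hD1, hD2, hD, hm⟩ := mesh0 h ι
  set a := Xi s ξ t ι with ha
  have a1 : a ≤ t := Xi_le s ξ hs t ι
  have a2 : t < a + 2 * s ι := Xi_gt s ξ hs t ι
  have hsθ : s ι * θ ≤ Real.pi / 2 := by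
    refine le_trans ?_ h.rθ
    apply mul_le_mul_of_nonneg_right _ h.θpos.le
    have := h.rpos
    rcases h.size ι with e | e <;> rw [e] <;> simp [this]
  have e := hm a (Xi_Ps s ξ t ι) (fun q => if q ≤ t then gS θ τ q else 0)
  have e2 : zf C s ξ d (gS θ τ) (Xi s ξ t) ι = d ι * gS θ τ a -
      (D2 * (if a + s ι ≤ t then gS θ τ (a + s ι) else 0) +
      D1 * ∑ k ∈ Finset.range (s ι), (if a + 1 + 2 * k ≤ t then gS θ τ (a + 1 + 2 * k) else 0)) := by
    rw [← e]
    unfold zf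
    congr 1
    refine Finset.sum_congr rfl fun j _ => ?_
    split_ifs with hj
    · unfold W
      rw [← Finset.sum_filter, Finset.filter_filter]
      congr 2
      ext q
      simp only [Finset.mem_filter, Finset.mem_Ioc, Finset.mem_Ioo]
      constructor
      · rintro ⟨⟨q1, q2⟩, q3⟩
        have := Xi_le s ξ hs t j
        exact ⟨⟨q1, by omega⟩, q3, by omega⟩
      · rintro ⟨⟨q1, q2⟩, q3, q4⟩
        refine ⟨⟨q1, ?_⟩, q3⟩
        by_contra hq
        have := Ps_gap (Xi_Ps s ξ t j) q3 (by omega)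
        have := Xi_gt s ξ hs t j
        omega
    · rfl
  rw [e2]
  have a1' : (a:ℝ) ≤ t := by exact_mod_cast a1
  have a2' : (t:ℝ) + 1 ≤ a + 2 * s ι := by exact_mod_cast a2
  set x : ℝ := τ - a with hx
  have hx0 : 0 < x := by linarith
  have hx1 : x < 2 * s ι := by linarith
  have hθ := h.θpos
  have hS : 0 < Real.sin (θ * x) := by
    apply Real.sin_pos_of_pos_of_lt_pi (mul_pos hθ hx0); nlinarith
  have eg : gS θ τ a = - Real.sin (θ * x) := by
    unfold gS; rw [← Real.sin_neg]; congr 1; rw [hx]; ring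
  have hc : 0 ≤ Real.cos (s ι * θ) := Real.cos_nonneg_of_neg_pi_div_two_le_of_le
    (by have : 0 ≤ s ι * θ := by positivity
        linarith) hsθ
  have hU := Us_pos (s ι) (hs ι) θ hθ.le hsθ
  have hd := h.dpos ι
  have H2 : 2 * Real.cos (s ι * θ) * -(if a + s ι ≤ t then gS θ τ (a + s ι) else 0) <
      Real.sin (θ * x) := by
    split_ifs
    · have := anal2 (s ι) θ x hθ hsθ hx0 hx1
      have e3 : -gS θ τ (a + s ι) = Real.sin (θ * (x - s ι)) := by
        unfold gS; rw [← Real.sin_neg]; congr 1; rw [hx]; push_cast; ring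
      rw [e3]; exact this
    · simpa using hS
  have H1 : 2 * Real.cos (s ι * θ) * -(∑ k ∈ Finset.range (s ι),
      (if a + 1 + 2 * k ≤ t then gS θ τ (a + 1 + 2 * k) else 0)) <
      Us (s ι) θ * Real.sin (θ * x) := by
    rw [← Finset.sum_neg_distrib]
    apply anal1 (s ι) (hs ι) θ x hθ hsθ hx0 hx1 _ (t + 1 - a)
    intro k
    have : (a + 1 + 2 * (k:ℤ) ≤ t) ↔ (1 + 2 * k : ℝ) < t + 1 - a := by
      rw [← Int.lt_add_one_iff]
      constructor
      · intro hh
        have : ((a + 1 + 2 * k : ℤ):ℝ) < ((t + 1 : ℤ) : ℝ) := by exact_mod_cast hh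
        push_cast at this; linarith
      · intro hh
        have : ((a + 1 + 2 * k : ℤ):ℝ) < ((t + 1 : ℤ) : ℝ) := by push_cast; linarith
        exact_mod_cast this
    simp only [this]
    split_ifs
    · unfold gS; rw [← Real.sin_neg]; congr 1; rw [hx]; push_cast; ring
    · simp
  rw [eg]
  generalize (if a + (s ι : ℤ) ≤ t then gS θ τ (a + s ι) else 0) = A at H2 ⊢
  generalize (∑ k ∈ Finset.range (s ι),
      (if a + 1 + 2 * (k:ℤ) ≤ t then gS θ τ (a + 1 + 2 * k) else 0)) = B at H1 ⊢
  rcases hc.eq_or_lt with hc0 | hc0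
  · rw [← hc0] at hD
    have : 0 ≤ Us (s ι) θ * D1 := mul_nonneg hU.le hD1
    have d2 : D2 = 0 := by linarith
    have d1 : D1 = 0 := by
      have : Us (s ι) θ * D1 = 0 := by linarith
      exact (mul_eq_zero.1 this).resolve_left hU.ne'
    rw [d1, d2]
    have := mul_pos hd hS
    linarith
  · have hpos : 0 < 2 * Real.cos (s ι * θ) * d ι := by positivity
    have key : 2 * Real.cos (s ι * θ) * (D2 * (-A) + D1 * (-B)) <
        2 * Real.cos (s ι * θ) * (d ι * Real.sin (θ * x)) := by
      have e3 : 2 * Real.cos (s ι * θ) * (d ι * Real.sin (θ * x)) =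
        D2 * Real.sin (θ * x) + D1 * (Us (s ι) θ * Real.sin (θ * x)) := by
        rw [← mul_assoc, ← hD]; ring
      have e4 : 2 * Real.cos (s ι * θ) * (D2 * (-A) + D1 * (-B)) =
        D2 * (2 * Real.cos (s ι * θ) * (-A)) + D1 * (2 * Real.cos (s ι * θ) * (-B)) := by ring
      rw [e3, e4]
      rcases hD2.eq_or_lt with h2 | h2
      · have h1 : 0 < D1 := by
          rcases hD1.eq_or_lt with h1 | h1
          · rw [← h1, ← h2] at hD; linarith
          · exact h1
        exact add_lt_add_of_le_of_lt (mul_le_mul_of_nonneg_left H2.le hD2)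
          (mul_lt_mul_of_pos_left H1 h1)
      · exact add_lt_add_of_lt_of_le (mul_lt_mul_of_pos_left H2 h2)
          (mul_le_mul_of_nonneg_left H1.le hD1)
    have := lt_of_mul_lt_mul_left key (by positivity)
    linarith


theorem Ps_adj {C : CartanADE J} {σ : Equiv.Perm J} {s : J → ℕ} {r : ℕ} {ξ : J → ℤ}
    (h : Good C σ s r ξ) {ι j : J} (hij : C.a ι j = -1) {q : ℤ} (h1 : Ps s ξ ι q)
    (h2 : Ps s ξ j q) : False := by
  unfold Ps at h1 h2
  by_cases e : s ι = s j
  · have h3 := h.eq ι j hij e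
    rw [← e] at h2
    have h4 := dvd_sub h2 h1
    have h5 := dvd_sub h4 h3
    have e5 : q - ξ j - (q - ξ ι) - (ξ ι - ξ j - s ι) = (s ι : ℤ) := by ring
    rw [e5] at h5
    have := h.spos ι
    have := Int.le_of_dvd (by omega) h5
    omega
  · have h1' : (2:ℤ) ∣ q - ξ ι := dvd_trans (by simp) h1
    have h2' : (2:ℤ) ∣ q - ξ j := dvd_trans (by simp) h2
    rcases h.size ι with e1 | e1 <;> rcases h.size j with e2 | e2
    · exact e (e1.trans e2.symm)
    · have := h.par ι j hij e1 e2 (by rintro rfl; exact e (e1.trans e2.symm))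
      omega
    · have := h.par j ι (by rw [C.symm]; exact hij) e2 e1 (by rintro rfl; exact e (e1.trans e2.symm))
      omega
    · exact e (e1.trans e2.symm)

theorem fl_AdL (C : CartanADE J) (s : J → ℕ) (l : List J) (η : J → ℤ) (hn : l.Nodup)
    (hl : ∀ ι ∈ l, IsSource C η ι) : AdL C s η l := by
  induction l generalizing η with
  | nil => trivial
  | cons κ l ih =>
    rw [List.nodup_cons] at hn
    refine ⟨hl κ (by simp), ih _ hn.2 fun ι hι j hj => ?_⟩
    have hne : ι ≠ κ := by rintro rfl; exact hn.1 hι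
    rw [fire_ne s η hne]
    exact lt_of_le_of_lt (fire_le s η κ j) (hl ι (by simp [hι]) j hj)

theorem fl_hA (s : J → ℕ) (l : List J) (η : J → ℤ) (hn : l.Nodup) (ι : J) :
    hA s η l ι = η ι - if ι ∈ l then 2 * (s ι : ℤ) else 0 := by
  induction l generalizing η with
  | nil => simp [hA]
  | cons κ l ih =>
    rw [List.nodup_cons] at hn
    have := ih (fire s η κ) hn.2
    change hA s (fire s η κ) l ι = _
    rw [this]
    by_cases e : ι = κ
    · subst e; simp [hn.1, fire_self]
    · simp [fire_ne s η e, e]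

theorem fl_act (C : CartanADE J) (l : List J) (hn : l.Nodup)
    (hl : ∀ ι ∈ l, ∀ j ∈ l, C.a ι j ≠ -1) (v : J → ℤ) :
    act C l v = v - ∑ ι ∈ l.toFinset, pairing C v (simpleRoot ι) • simpleRoot ι := by
  induction l with
  | nil => simp [act_nil]
  | cons κ l ih =>
    rw [List.nodup_cons] at hn
    rw [act_cons, ih hn.2 (fun ι hι j hj => hl ι (by simp [hι]) j (by simp [hj])), refl_eq]
    have e : pairing C (v - ∑ ι ∈ l.toFinset, pairing C v (simpleRoot ι) • simpleRoot ι)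
        (simpleRoot κ) = pairing C v (simpleRoot κ) := by
      rw [pairing_sub_left]
      have : pairing C (∑ ι ∈ l.toFinset, pairing C v (simpleRoot ι) • simpleRoot ι)
          (simpleRoot κ) = 0 := by
        rw [pairing_simple]
        apply Finset.sum_eq_zero
        intro j _
        by_cases hj : C.a j κ = 0
        · rw [hj, mul_zero]
        · rw [Finset.sum_apply, Finset.sum_eq_zero, zero_mul]
          intro i hi
          have hi : i ∈ l := by simpa using hi
          have : i ≠ j := by
            rintro rfl
            rcases C.offDiag i κ (by rintro rfl; exact hn.1 hi) with h0 | h0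
            · exact hj h0
            · exact hl i (by simp [hi]) κ (by simp) h0
          simp [simpleRoot, this.symm]
      rw [this, sub_zero]
    rw [e, List.toFinset_cons, Finset.sum_insert (by simpa using hn.1)]
    abel

/-- The vertices at level `t`. -/
noncomputable def Fs (s : J → ℕ) (ξ : J → ℤ) (t : ℤ) : Finset J :=
  Finset.univ.filter fun ι => Ps s ξ ι t

theorem mem_Fs (s : J → ℕ) (ξ : J → ℤ) (t : ℤ) (ι : J) : ι ∈ Fs s ξ t ↔ Ps s ξ ι t := by
  simp [Fs]

noncomputable def uL (s : J → ℕ) (ξ : J → ℤ) : ℤ → ℕ → List J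
  | _, 0 => []
  | t, n + 1 => (Fs s ξ t).toList ++ uL s ξ (t - 1) n

theorem uL_succ (s : J → ℕ) (ξ : J → ℤ) (t : ℤ) (n : ℕ) :
    uL s ξ t (n + 1) = uL s ξ t n ++ (Fs s ξ (t - n)).toList := by
  induction n generalizing t with
  | zero => simp [uL]
  | succ n ih =>
    rw [uL, ih (t - 1), uL, List.append_assoc]
    congr 4; push_cast; ring

theorem Xi_source {C : CartanADE J} {σ : Equiv.Perm J} {s : J → ℕ} {r : ℕ} {ξ : J → ℤ}
    (h : Good C σ s r ξ) (t : ℤ) (ι : J) (hι : Ps s ξ ι t) : IsSource C (Xi s ξ t) ι := by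
  have hs : ∀ ι, 1 ≤ s ι := fun ι => h.spos ι
  intro j hj
  rw [Xi_uniq s ξ hs t ι t hι le_rfl (by have := hs ι; omega)]
  refine lt_of_le_of_ne (Xi_le s ξ hs t j) fun e => ?_
  have := Xi_Ps s ξ t j
  rw [e] at this
  exact Ps_adj h hj hι this

theorem Xi_step {C : CartanADE J} {σ : Equiv.Perm J} {s : J → ℕ} {r : ℕ} {ξ : J → ℤ}
    (h : Good C σ s r ξ) (t : ℤ) :
    AdL C s (Xi s ξ t) (Fs s ξ t).toList ∧
      hA s (Xi s ξ t) (Fs s ξ t).toList = Xi s ξ (t - 1) := by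
  have hs : ∀ ι, 1 ≤ s ι := fun ι => h.spos ι
  refine ⟨fl_AdL C s _ _ (Finset.nodup_toList _) fun ι hι => Xi_source h t ι ?_, ?_⟩
  · simpa [Fs] using hι
  · funext ι
    rw [fl_hA _ _ _ (Finset.nodup_toList _)]
    simp only [Finset.mem_toList, mem_Fs]
    symm
    have h1 := hs ι
    have hP := Xi_Ps s ξ t ι
    have h2 := Xi_le s ξ hs t ι
    have h3 := Xi_gt s ξ hs t ι
    split_ifs with hι
    · have e := Xi_uniq s ξ hs t ι t hι le_rfl (by omega)
      rw [e]
      apply Xi_uniq s ξ hs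
      · unfold Ps at hι ⊢
        have := dvd_sub hι (dvd_refl (2 * (s ι:ℤ)))
        rwa [sub_right_comm] at this
      · omega
      · omega
    · rw [sub_zero]
      apply Xi_uniq s ξ hs _ _ _ hP
      · have : Xi s ξ t ι ≠ t := by intro e; rw [e] at hP; exact hι hP
        omega
      · omega

theorem uL_AdL {C : CartanADE J} {σ : Equiv.Perm J} {s : J → ℕ} {r : ℕ} {ξ : J → ℤ}
    (h : Good C σ s r ξ) (n : ℕ) (t : ℤ) :
    AdL C s (Xi s ξ t) (uL s ξ t n) ∧ hA s (Xi s ξ t) (uL s ξ t n) = Xi s ξ (t - n) := by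
  induction n generalizing t with
  | zero => exact ⟨trivial, by simp [uL, hA]⟩
  | succ n ih =>
    obtain ⟨a1, a2⟩ := Xi_step h t
    obtain ⟨b1, b2⟩ := ih (t - 1)
    rw [uL, AdL_append, hA_append, a2]
    refine ⟨⟨a1, b1⟩, ?_⟩
    rw [b2]; congr 1; push_cast; ring

theorem betas_root (C : CartanADE J) (u : List J) : ∀ β ∈ betas C u, pairing C β β = 2 := by
  induction u with
  | nil => simp [betas]
  | cons ι u ih =>
    intro β hβ
    simp only [betas, List.mem_cons, List.mem_map] at hβ
    rcases hβ with rfl | ⟨β', hβ', rfl⟩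
    · rw [pairing_simple_simple, C.diag]
    · rw [refl_isom]; exact ih β' hβ'

theorem Zf_neg_of_pos (C : CartanADE J) (s : J → ℕ) (ξ : J → ℤ) (d : J → ℝ) (g : ℤ → ℝ)
    (η : J → ℤ) (hz : ∀ ι, zf C s ξ d g η ι < 0) (β : J → ℤ) (hβ : β ∈ posRoots C) :
    Zf C s ξ d g η β < 0 := by
  obtain ⟨κ, hκ⟩ : ∃ κ, β κ ≠ 0 := by
    by_contra hh; push Not at hh; exact hβ.2.1 (funext hh)
  unfold Zf
  refine Finset.sum_neg' ?_ ⟨κ, Finset.mem_univ _, ?_⟩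
  · intro ι _
    have h1 : (0:ℝ) ≤ β ι := by exact_mod_cast hβ.1 ι
    exact mul_nonpos_of_nonneg_of_nonpos h1 (hz ι).le
  · have h1 : (0:ℝ) < β κ := by exact_mod_cast lt_of_le_of_ne (hβ.1 κ) hκ.symm
    exact mul_neg_of_pos_of_neg h1 (hz κ)

theorem Zf_negv (C : CartanADE J) (s : J → ℕ) (ξ : J → ℤ) (d : J → ℝ) (g : ℤ → ℝ)
    (η : J → ℤ) (β : J → ℤ) : Zf C s ξ d g η (-β) = - Zf C s ξ d g η β := by
  unfold Zf; rw [← Finset.sum_neg_distrib]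
  exact Finset.sum_congr rfl fun ι _ => by simp

theorem zf_negg (C : CartanADE J) (s : J → ℕ) (ξ : J → ℤ) (d : J → ℝ) (g : ℤ → ℝ)
    (η : J → ℤ) (ι : J) : zf C s ξ d (fun q => - g q) η ι = - zf C s ξ d g η ι := by
  have e : ∀ j a b, W s ξ (fun q => - g q) j a b = - W s ξ g j a b := by
    intro j a b; unfold W; rw [Finset.sum_neg_distrib]
  unfold zf
  simp only [e, mul_neg]
  have : (∑ j, if C.a ι j = -1 then -(d j * W s ξ g j (η ι) (η j)) else 0) =
      - ∑ j, if C.a ι j = -1 then (d j * W s ξ g j (η ι) (η j)) else 0 := by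
    rw [← Finset.sum_neg_distrib]
    exact Finset.sum_congr rfl fun j _ => by split_ifs <;> simp
  rw [this]; ring

theorem exists_N (c : ℝ) (hc : 1 ≤ c) :
    ∃ (τ : ℝ) (N : ℕ), 0 < τ ∧ τ < 1 ∧ (N:ℝ) - 1 < c - τ ∧ c - τ < N := by
  have key : ∀ τ : ℝ, 0 < τ → τ < 1 → (∀ n : ℕ, c - τ ≠ n) →
      ∃ (τ : ℝ) (N : ℕ), 0 < τ ∧ τ < 1 ∧ (N:ℝ) - 1 < c - τ ∧ c - τ < N := by
    intro τ h0 h1 h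
    refine ⟨τ, ⌊c - τ⌋₊ + 1, h0, h1, ?_, ?_⟩
    · have := Nat.floor_le (a := c - τ) (by linarith)
      push_cast
      have := lt_of_le_of_ne this (h _).symm
      linarith
    · push_cast; exact Nat.lt_floor_add_one _
  by_cases h : ∀ n : ℕ, c - 1/2 ≠ n
  · exact key (1/2) (by norm_num) (by norm_num) h
  · push Not at h
    obtain ⟨n, hn⟩ := h
    apply key (1/3) (by norm_num) (by norm_num)
    intro m hm
    have : (6:ℝ) * m = 6 * n + 1 := by linarith
    have : 6 * m = 6 * n + 1 := by exact_mod_cast this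
    omega

theorem uL_Red {C : CartanADE J} {σ : Equiv.Perm J} {s : J → ℕ} {r : ℕ} {ξ : J → ℤ} {θ : ℝ}
    {d : J → ℝ} (h : Eig C σ s r ξ θ d) : ∃ N : ℕ, ∀ t, Red C (uL s ξ t N) := by
  have hs : ∀ ι, 1 ≤ s ι := fun ι => h.spos ι
  have hθ := h.θpos
  have hp := Real.pi_pos
  obtain ⟨τ0, N, h0, h1, h2, h3⟩ := exists_N (Real.pi / θ) (by
    rw [le_div_iff₀ hθ]
    have h1 := h.rθ
    have h2 : (1:ℝ) ≤ r := by exact_mod_cast h.rpos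
    nlinarith)
  refine ⟨N, fun t => ?_⟩
  obtain ⟨a1, a2⟩ := uL_AdL h.toGood N t
  have hsl := Xi_IsSl C s ξ hs t
  have hz := fun ι => Xi_neg h t (t + τ0) (by linarith) (by linarith) ι
  have hcθ : Real.pi / θ * θ = Real.pi := by field_simp
  constructor
  · intro β hβ
    obtain ⟨κ, p, e, p1, p2⟩ := Zf_betas h (t + τ0) _ _ hsl a1 β hβ
    rw [a2] at p1
    have p3 := Xi_gt s ξ hs (t - N) κ
    have p4 := Xi_le s ξ hs t κ
    have p5 : (t:ℝ) - N + 1 ≤ p := by exact_mod_cast (by omega : t - N + 1 ≤ p)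
    have p6 : (p:ℝ) ≤ t := by exact_mod_cast (by omega : p ≤ t)
    have hneg : Zf C s ξ d (gS θ (t + τ0)) (Xi s ξ t) β < 0 := by
      rw [e]
      apply mul_neg_of_pos_of_neg (h.dpos κ)
      unfold gS
      apply Real.sin_neg_of_neg_of_neg_pi_lt
      · apply mul_neg_of_pos_of_neg hθ; linarith
      · have : -(Real.pi / θ) < p - (t + τ0) := by linarith
        have := mul_lt_mul_of_pos_left this hθ
        linarith
    rcases pos_or_neg C β (betas_root C _ β hβ) with hh | hh
    · exact hh
    · exfalso
      have := Zf_neg_of_pos C s ξ d _ _ hz _ hh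
      rw [Zf_negv] at this
      linarith
  · intro ι
    have e : Zf C s ξ d (gS θ (t + τ0)) (Xi s ξ t) (act C (uL s ξ t N) (simpleRoot ι)) =
      - zf C s ξ d (gS θ (t + τ0 - Real.pi / θ)) (Xi s ξ (t - N)) ι := by
      rw [Zf_act h _ _ _ _ hsl a1, a2, Zf_simple, ← zf_negg]
      congr 1
      funext q
      unfold gS
      rw [← Real.sin_sub_pi]
      congr 1
      linear_combination (-1) * hcθ
    have h5 := Xi_neg h (t - N) (t + τ0 - Real.pi / θ) (by push_cast; linarith)
      (by push_cast; linarith) ι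
    rcases pos_or_neg C (act C (uL s ξ t N) (simpleRoot ι))
      (by rw [act_isom, pairing_simple_simple, C.diag]) with hh | hh
    · exfalso
      have := Zf_neg_of_pos C s ξ d _ _ hz _ hh
      linarith
    · exact hh


theorem act_inj (C : CartanADE J) (u : List J) {v w : J → ℤ} (h : act C u v = act C u w) : v = w := by
  have := congrArg (act C u.reverse) h
  simpa only [act_reverse, act_reverse'] using this

theorem simple_inj {ι κ : J} (h : (simpleRoot ι : J → ℤ) = simpleRoot κ) : ι = κ := by
  have := congrFun h ι
  by_contra hne
  simp [simpleRoot, hne] at this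

theorem act_sub (C : CartanADE J) (u : List J) (v w : J → ℤ) :
    act C u (v - w) = act C u v - act C u w := by
  rw [sub_eq_add_neg, act_add, act_neg, ← sub_eq_add_neg]

theorem Fs_nonadj {C : CartanADE J} {σ : Equiv.Perm J} {s : J → ℕ} {r : ℕ} {ξ : J → ℤ}
    (h : Good C σ s r ξ) (t : ℤ) :
    ∀ ι ∈ (Fs s ξ t).toList, ∀ j ∈ (Fs s ξ t).toList, C.a ι j ≠ -1 := by
  intro ι hι j hj e
  rw [Finset.mem_toList, mem_Fs] at hι hj
  exact Ps_adj h e hι hj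

theorem Fs_act {C : CartanADE J} {σ : Equiv.Perm J} {s : J → ℕ} {r : ℕ} {ξ : J → ℤ}
    (h : Good C σ s r ξ) (t : ℤ) (v : J → ℤ) : act C (Fs s ξ t).toList v =
      v - ∑ ι ∈ Fs s ξ t, pairing C v (simpleRoot ι) • simpleRoot ι := by
  rw [fl_act C _ (Finset.nodup_toList _) (Fs_nonadj h t), Finset.toList_toFinset]

theorem Fs_act_simple {C : CartanADE J} {σ : Equiv.Perm J} {s : J → ℕ} {r : ℕ} {ξ : J → ℤ}
    (h : Good C σ s r ξ) (t : ℤ) {ι : J} (hι : ι ∈ Fs s ξ t) :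
    act C (Fs s ξ t).toList (simpleRoot ι) = - simpleRoot ι := by
  rw [Fs_act h, Finset.sum_eq_single ι]
  · rw [pairing_simple_simple, C.diag, two_smul]; abel
  · intro j hj hne
    rw [mem_Fs] at hι hj
    rw [pairing_simple_simple]
    rcases C.offDiag ι j hne.symm with e | e
    · rw [e, zero_smul]
    · exact (Ps_adj h e hι hj).elim
  · intro hh; exact (hh hι).elim

theorem fl_betas (C : CartanADE J) (l : List J) (hn : l.Nodup)
    (hl : ∀ ι ∈ l, ∀ j ∈ l, C.a ι j ≠ -1) : ∀ β ∈ betas C l, ∃ ι ∈ l, β = simpleRoot ι := by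
  induction l with
  | nil => simp [betas]
  | cons κ l ih =>
    intro β hβ
    rw [List.nodup_cons] at hn
    simp only [betas, List.mem_cons, List.mem_map] at hβ
    rcases hβ with rfl | ⟨β', hβ', rfl⟩
    · exact ⟨κ, by simp, rfl⟩
    · obtain ⟨ι, hι, rfl⟩ := ih hn.2 (fun ι hι j hj => hl ι (by simp [hι]) j (by simp [hj])) β' hβ'
      refine ⟨ι, by simp [hι], ?_⟩
      have hne : κ ≠ ι := by rintro rfl; exact hn.1 hι
      have h0 : C.a κ ι = 0 := (C.offDiag κ ι hne).resolve_right (hl κ (by simp) ι (by simp [hι]))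
      exact refl_simple_zero C h0

section
variable {C : CartanADE J} {σ : Equiv.Perm J} {s : J → ℕ} {r : ℕ} {ξ : J → ℤ} {N : ℕ}

theorem star_ex (h : Good C σ s r ξ) (hR : ∀ t, Red C (uL s ξ t N)) (t : ℤ) (ι : J)
    (hι : ι ∈ Fs s ξ t) : ∃ κ ∈ Fs s ξ (t - N),
      act C (uL s ξ t N) (simpleRoot κ) = - simpleRoot ι := by
  have e : (Fs s ξ t).toList ++ uL s ξ (t - 1) N = uL s ξ t N ++ (Fs s ξ (t - N)).toList := by
    rw [← uL_succ]; rfl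
  have h1 : - simpleRoot ι ∈ betas C ((Fs s ξ t).toList ++ uL s ξ (t - 1) N) := by
    rw [betas_append, List.mem_append, List.mem_map]
    exact Or.inr ⟨simpleRoot ι, allneg_full C _ (hR (t - 1)).2 _ (simple_mem C ι),
      Fs_act_simple h t hι⟩
  rw [e, betas_append, List.mem_append, List.mem_map] at h1
  rcases h1 with h1 | ⟨β, hβ, h1⟩
  · exact (not_pos_neg C _ (simple_mem C ι) ((hR t).1 _ h1)).elim
  · obtain ⟨κ, hκ, rfl⟩ := fl_betas C _ (Finset.nodup_toList _) (Fs_nonadj h _) β hβ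
    exact ⟨κ, by simpa using hκ, h1⟩

theorem Fs_card (hR : ∀ t, Red C (uL s ξ t N)) (t : ℤ) :
    (Fs s ξ t).card = (Fs s ξ (t - N)).card := by
  have e : (Fs s ξ t).toList ++ uL s ξ (t - 1) N = uL s ξ t N ++ (Fs s ξ (t - N)).toList := by
    rw [← uL_succ]; rfl
  have := congrArg List.length e
  have h1 := Red_ncard C _ (hR t)
  have h2 := Red_ncard C _ (hR (t - 1))
  simp only [List.length_append, Finset.length_toList] at this
  omega

theorem u_step (h : Good C σ s r ξ) (hR : ∀ t, Red C (uL s ξ t N)) (t : ℤ) (v : J → ℤ) :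
    act C (uL s ξ (t - 1) N) v = act C (uL s ξ t N) v := by
  have e : (Fs s ξ t).toList ++ uL s ξ (t - 1) N = uL s ξ t N ++ (Fs s ξ (t - N)).toList := by
    rw [← uL_succ]; rfl
  have e2 : act C (Fs s ξ t).toList (act C (uL s ξ (t - 1) N) v) =
      act C (uL s ξ t N) (act C (Fs s ξ (t - N)).toList v) := by
    rw [← act_append, e, act_append]
  apply act_inj C (Fs s ξ t).toList
  rw [e2, Fs_act h, Fs_act h, act_sub]
  congr 1
  have e3 : ∀ S : Finset J, act C (uL s ξ t N) (∑ ι ∈ S, pairing C v (simpleRoot ι) • simpleRoot ι) =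
      ∑ ι ∈ S, pairing C v (simpleRoot ι) • act C (uL s ξ t N) (simpleRoot ι) := by
    intro S
    change actL C (uL s ξ t N) _ = _
    rw [map_sum]
    refine Finset.sum_congr rfl fun i _ => ?_
    rw [map_smul]; rfl
  rw [e3]
  have hex := star_ex h hR t
  choose! f hf1 hf2 using hex
  symm
  refine Finset.sum_bij (fun ι _ => f ι) hf1 ?_ ?_ ?_
  · intro a ha b hb hab
    have := hf2 a ha
    rw [hab, hf2 b hb] at this
    exact (simple_inj (neg_injective this)).symm
  · intro b hb
    have := Finset.surj_on_of_inj_on_of_card_le (s := Fs s ξ t) (t := Fs s ξ (t - N))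
      (fun ι _ => f ι) hf1 ?_ (Fs_card hR t).ge b hb
    · obtain ⟨a, ha, hab⟩ := this
      exact ⟨a, ha, hab.symm⟩
    · intro a b ha hb hab
      have := hf2 a ha
      rw [hab, hf2 b hb] at this
      exact (simple_inj (neg_injective this)).symm
  · intro a ha
    rw [hf2 a ha, ← act_isom C (uL s ξ t N) v, hf2 a ha, pairing_neg_right]
    simp

theorem u_const (h : Good C σ s r ξ) (hR : ∀ t, Red C (uL s ξ t N)) (t : ℤ) (v : J → ℤ) :
    act C (uL s ξ t N) v = act C (uL s ξ 0 N) v := by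
  induction t using Int.induction_on with
  | zero => rfl
  | succ i ih => rw [← u_step h hR, add_sub_cancel_right]; exact ih
  | pred i ih => rw [u_step h hR]; exact ih

theorem star_main (h : Good C σ s r ξ) (hR : ∀ t, Red C (uL s ξ t N)) : ∃ st : J → J,
    Function.Surjective st ∧ (∀ ι, s (st ι) = s ι) ∧
    (∀ t ι, act C (uL s ξ t N) (simpleRoot (st ι)) = - simpleRoot ι) ∧
    ∀ t ι, Xi s ξ (t - N) (st ι) = Xi s ξ t ι - N := by
  have hs : ∀ ι, 1 ≤ s ι := fun ι => h.spos ι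
  have hex : ∀ ι, ∃ κ, act C (uL s ξ 0 N) (simpleRoot κ) = - simpleRoot ι := by
    intro ι
    obtain ⟨κ, -, hκ⟩ := star_ex h hR (ξ ι) ι (by rw [mem_Fs]; simp [Ps])
    rw [u_const h hR] at hκ
    exact ⟨κ, hκ⟩
  choose st hst using hex
  have hinj : Function.Injective st := by
    intro a b hab
    have := hst a
    rw [hab, hst b] at this
    exact (simple_inj (neg_injective this)).symm
  have hPs : ∀ t ι, Ps s ξ ι t → Ps s ξ (st ι) (t - N) := by
    intro t ι hι
    obtain ⟨κ, h1, h2⟩ := star_ex h hR t ι (by rwa [mem_Fs])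
    rw [u_const h hR, ← hst ι] at h2
    rw [← simple_inj (act_inj C _ h2)]
    rwa [mem_Fs] at h1
  have hle : ∀ ι, s (st ι) ≤ s ι := by
    intro ι
    have h1 := hPs (ξ ι) ι (by simp [Ps])
    have h2 := hPs (ξ ι + 2 * s ι) ι (by simp [Ps])
    unfold Ps at h1 h2
    have h3 := dvd_sub h2 h1
    have e : ξ ι + 2 * (s ι : ℤ) - N - ξ (st ι) - (ξ ι - N - ξ (st ι)) = 2 * s ι := by ring
    rw [e] at h3
    have := hs ι
    have := Int.le_of_dvd (by omega) h3
    omega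
  have hbij : Function.Bijective st := Finite.injective_iff_bijective.1 hinj
  have heq : ∀ ι, s (st ι) = s ι := by
    have hsum : ∑ ι, s (st ι) = ∑ ι, s ι := hbij.sum_comp s
    have := (Finset.sum_eq_sum_iff_of_le (fun ι _ => hle ι)).1 hsum
    exact fun ι => this ι (Finset.mem_univ _)
  refine ⟨st, hbij.2, heq, fun t ι => by rw [u_const h hR]; exact hst ι, fun t ι => ?_⟩
  have h1 := Xi_le s ξ hs t ι
  have h2 := Xi_gt s ξ hs t ι
  apply Xi_uniq s ξ hs
  · exact hPs _ _ (Xi_Ps s ξ t ι)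
  · omega
  · rw [heq]; omega

/-- The descent invariant. -/
def TT (C : CartanADE J) (s : J → ℕ) (N : ℕ) (st : J → J) (η : J → ℤ) : Prop :=
  ∃ v, AdL C s η v ∧ Red C v ∧ (∀ κ, act C v (simpleRoot (st κ)) = - simpleRoot κ) ∧
    ∀ κ, hA s η v (st κ) = η κ - N

theorem TT_step (st : J → J) (hsur : Function.Surjective st) (hss : ∀ ι, s (st ι) = s ι)
    (η : J → ℤ) (hT : TT C s N st η) (ι : J) (hι : IsSource C η ι) : TT C s N st (fire s η ι) := by
  obtain ⟨v, hv, hR, hst, hh⟩ := hT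
  have ha : ∀ κ κ', C.a (st κ) (st κ') = C.a κ κ' := by
    intro κ κ'
    rw [← pairing_simple_simple, ← act_isom C v, hst, hst, pairing_neg_left, pairing_neg_right,
      neg_neg, pairing_simple_simple]
  have hm : ι ∈ v := mem_of_simple C v ι (allneg_full C v hR.2 _ (simple_mem C ι))
  obtain ⟨v', hv'⟩ := pull C s v ι η hv hι hm
  have hAd : AdL C s η (ι :: v') := LComm_AdL C s η hv' hv
  have hhA : hA s (fire s η ι) v' = hA s η v := (LComm_hA C s η hv').symm
  have hact : ∀ z, act C v' z = reflS C ι (act C v z) := by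
    intro z
    rw [LComm_act C hv' z, act_cons, refl_invol]
  have hbp := LComm_betas C hv'
  have hpos : ∀ β ∈ betas C (ι :: v'), β ∈ posRoots C := fun β hβ =>
    hR.1 β (by first | exact hbp.mem_iff.1 hβ | exact hbp.mem_iff.2 hβ)
  have hnd := betas_nodup C _ hpos
  have hnew : ∀ κ, act C (v' ++ [st ι]) (simpleRoot (st κ)) = - simpleRoot κ := by
    intro κ
    rw [act_append, act_cons, act_nil, hact, refl_eq C (st ι), pairing_simple_simple, ha, act_sub,
      act_smul, hst, hst]
    have : -simpleRoot κ - C.a κ ι • -simpleRoot ι = -(reflS C ι (simpleRoot κ)) := by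
      rw [refl_eq, pairing_simple_simple, smul_neg]; abel
    rw [this, refl_neg, refl_invol]
  refine ⟨v' ++ [st ι], ?_, ⟨?_, ?_⟩, hnew, ?_⟩
  · rw [AdL_append]
    refine ⟨hAd.2, ?_, trivial⟩
    rw [hhA]
    intro j hj
    obtain ⟨κ, rfl⟩ := hsur j
    rw [ha] at hj
    rw [hh, hh]
    have := hι κ hj
    omega
  · intro β hβ
    rw [betas_append, List.mem_append] at hβ
    rcases hβ with hβ | hβ
    · have h1 : reflS C ι β ∈ (betas C v').map (reflS C ι) := List.mem_map_of_mem hβ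
      have h2 := hpos (reflS C ι β) (by simp only [betas, List.mem_cons]; exact Or.inr h1)
      have hne : reflS C ι β ≠ simpleRoot ι := by
        intro e
        rw [e] at h1
        simp only [betas, List.nodup_cons] at hnd
        exact hnd.1 h1
      have := refl_pos C ι _ h2 hne
      rwa [refl_invol] at this
    · simp only [betas, List.map_nil, List.map_cons, List.mem_singleton] at hβ
      rw [hβ, hact, hst, refl_neg, refl_simple, neg_neg]
      exact simple_mem C ι
  · intro j
    obtain ⟨κ, rfl⟩ := hsur j
    rw [hnew, neg_neg]
    exact simple_mem C κ
  · intro κ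
    rw [hA_append, hhA]
    change fire s (hA s η v) (st ι) (st κ) = _
    by_cases e : κ = ι
    · subst e
      rw [fire_self, fire_self, hh, hss]; ring
    · have hne : st κ ≠ st ι := by
        intro e2
        have h1 := hst κ
        rw [e2, hst ι] at h1
        exact e (simple_inj (neg_injective h1)).symm
      rw [fire_ne _ _ hne, fire_ne _ _ e, hh]

theorem TT_desc (h : Good C σ s r ξ) (st : J → J) (hsur : Function.Surjective st)
    (hss : ∀ ι, s (st ι) = s ι) (n : ℕ) (η : J → ℤ) (hP : ∀ ι, Ps s ξ ι (η ι))
    (hge : ∀ ι, ξ ι ≤ η ι) (hn : ∑ ι, (η ι - ξ ι) ≤ n) (hT : TT C s N st η) : TT C s N st ξ := by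
  induction n generalizing η with
  | zero =>
    have h0 : ∑ ι, (η ι - ξ ι) = 0 := le_antisymm (by simpa using hn)
      (Finset.sum_nonneg fun ι _ => by have := hge ι; omega)
    rw [Finset.sum_eq_zero_iff_of_nonneg (fun ι _ => by have := hge ι; omega)] at h0
    have : η = ξ := funext fun ι => by have := h0 ι (Finset.mem_univ _); omega
    rwa [this] at hT
  | succ n ih =>
    by_cases hex : ∃ ι, ξ ι < η ι
    swap
    · push Not at hex
      have : η = ξ := funext fun ι => le_antisymm (hex ι) (hge ι)
      rwa [this] at hT
    · obtain ⟨ι0, h0⟩ := hex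
      obtain ⟨ι, hι, hmax⟩ := Finset.exists_max_image (Finset.univ.filter fun ι => ξ ι < η ι) η
        ⟨ι0, by simp [h0]⟩
      have hι : ξ ι < η ι := by simpa using hι
      have hgap : ξ ι + 2 * s ι ≤ η ι := Ps_gap (by simp [Ps]) (hP ι) hι
      have hsrc : IsSource C η ι := by
        intro j hj
        by_cases hj' : ξ j < η j
        · refine lt_of_le_of_ne (hmax j (by simp [hj'])) fun e => ?_
          have := hP j
          rw [e] at this
          exact Ps_adj h hj (hP ι) this
        · have e : η j = ξ j := le_antisymm (not_lt.1 hj') (hge j)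
          rw [e]
          exact lt_of_lt_of_le (h.slice j ι (by rw [C.symm]; exact hj)) hgap
      have hs := h.spos ι
      refine ih (fire s η ι) ?_ ?_ ?_ (TT_step st hsur hss η hT ι hsrc)
      · intro j
        by_cases e : j = ι
        · subst e
          rw [fire_self]
          have := dvd_sub (hP j) (dvd_refl (2 * (s j:ℤ)))
          rwa [sub_right_comm] at this
        · rw [fire_ne _ _ e]; exact hP j
      · intro j
        by_cases e : j = ι
        · subst e; rw [fire_self]; omega
        · rw [fire_ne _ _ e]; exact hge j
      · have : ∑ j, (fire s η ι j - ξ j) = ∑ j, (η j - ξ j) - 2 * s ι := by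
          have e1 : ∀ j, fire s η ι j - ξ j = (η j - ξ j) - if j = ι then 2 * (s ι:ℤ) else 0 := by
            intro j; unfold fire; ring
          simp only [e1]
          rw [Finset.sum_sub_distrib]
          simp
        rw [this]
        push_cast at hn
        omega
end

theorem exists_Red (C : CartanADE J) (D : DiagAut C) (ξ : J → ℤ) (hξ : IsHeightFunction C D ξ) :
    ∃ u, Red C u ∧ AdL C (orbitSize D.σ) ξ u := by
  rcases isEmpty_or_nonempty J with hJ | hJ
  · refine ⟨[], ⟨by simp [betas], fun ι => (hJ.false ι).elim⟩, trivial⟩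
  · have hG := good_of_height C D ξ hξ
    obtain ⟨θ, d, h1, h2, h3, h4, h5⟩ := eigen C D.σ (orbitSize D.σ) (orderOf D.σ) ξ hG
    have hE : Eig C D.σ (orbitSize D.σ) (orderOf D.σ) ξ θ d := ⟨hG, h1, h2, h3, h4, h5⟩
    have hs : ∀ ι, 1 ≤ orbitSize D.σ ι := fun ι => hG.spos ι
    obtain ⟨N, hR⟩ := uL_Red hE
    obtain ⟨st, a1, a2, a3, a4⟩ := star_main hG hR
    obtain ⟨t, ht⟩ : ∃ t : ℤ, ∀ ι, ξ ι ≤ t := by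
      obtain ⟨ι, hι⟩ := Finite.exists_max ξ
      exact ⟨ξ ι, hι⟩
    have hT : TT C (orbitSize D.σ) N st (Xi (orbitSize D.σ) ξ t) := by
      obtain ⟨b1, b2⟩ := uL_AdL hG N t
      exact ⟨_, b1, hR t, a3 t, fun κ => by rw [b2]; exact a4 t κ⟩
    have hge : ∀ ι, ξ ι ≤ Xi (orbitSize D.σ) ξ t ι := by
      intro ι
      by_contra hlt
      have := Ps_gap (Xi_Ps (orbitSize D.σ) ξ t ι) (q := ξ ι) (by simp [Ps]) (by omega)
      have := Xi_gt (orbitSize D.σ) ξ hs t ι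
      have := ht ι
      omega
    obtain ⟨v, c1, c2, -⟩ := TT_desc hG st a1 a2
      (∑ ι, (Xi (orbitSize D.σ) ξ t ι - ξ ι)).toNat _ (Xi_Ps _ ξ t) hge (Int.self_le_toNat _) hT
    exact ⟨v, c2, c1⟩

/-- Fujita–Oh Theorem 2.24: for a Q-datum `Q`, the Q-adapted reduced
words of `w₀` are nonempty and form a single commutation equivalence class. -/
theorem statement4 (C : CartanADE J) (D : DiagAut C) (ξ : J → ℤ)
    (hξ : IsHeightFunction C D ξ) :
    (∃ ii : Fin ((posRoots C).ncard) → J, IsReducedWord C ii ∧ IsAdapted C D ξ ii) ∧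
    (∀ (L : ℕ) (ii jj : Fin L → J), IsReducedWord C ii → IsAdapted C D ξ ii →
        IsReducedWord C jj → IsAdapted C D ξ jj → CommEquiv C ii jj) ∧
    (∀ (L : ℕ) (ii jj : Fin L → J), IsReducedWord C ii → IsAdapted C D ξ ii →
        IsReducedWord C jj → CommEquiv C ii jj → IsAdapted C D ξ jj) := by
  obtain ⟨u, hu, ha⟩ := exists_Red C D ξ hξ
  refine ⟨Red_word C D ξ u hu ha, ?_, ?_⟩
  · intro L ii jj hi hi' hj hj'
    exact part2 C D ξ ii jj hi hi' hj hj'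
  · intro L ii jj _ h _ hc
    exact part3 C D ξ ii jj h hc

end QDatumPaper
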